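/- Let n ≥ 0. Every countable model of DB₀ + TCo + Coll(Σ_{n+2}) has a Σ_{n+2}-elementary end extension that is taller*; moreover, every countable model of DB₀ + TCo that satisfies the full collection schema Coll has a fully elementary end extension that is taller*. -/

import Mathlib

/- A deep embedding of the first-order language of set theory L_∈ = {∈, =},
   with named variables indexed by ℕ. -/

namespace FOSet

/-- Formulas of L_∈ with variables indexed by ℕ. -/
inductive Fml : Type
  | mem : ℕ → ℕ → Fml
  | eq  : ℕ → ℕ → Fml
  | not : Fml → Fml
  | and : Fml → Fml → Fml
  | or  : Fml → Fml → Fml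
  | imp : Fml → Fml → Fml
  | all : ℕ → Fml → Fml
  | ex  : ℕ → Fml → Fml

namespace Fml

/-- Free variables of a formula. -/
def fv : Fml → Set ℕ
  | mem i j => {i, j}
  | eq i j  => {i, j}
  | not φ   => φ.fv
  | and φ ψ => φ.fv ∪ ψ.fv
  | or φ ψ  => φ.fv ∪ ψ.fv
  | imp φ ψ => φ.fv ∪ ψ.fv
  | all i φ => φ.fv \ {i}
  | ex i φ  => φ.fv \ {i}

end Fml

/-- Satisfaction, in the substructure of `(N, E)` with domain `S`, of a formula
under a valuation `v` : quantifiers range over `S`. -/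
def SatIn {N : Type} (E : N → N → Prop) (S : Set N) : (ℕ → N) → Fml → Prop
  | v, .mem i j => E (v i) (v j)
  | v, .eq i j  => v i = v j
  | v, .not φ   => ¬ SatIn E S v φ
  | v, .and φ ψ => SatIn E S v φ ∧ SatIn E S v ψ
  | v, .or φ ψ  => SatIn E S v φ ∨ SatIn E S v ψ
  | v, .imp φ ψ => SatIn E S v φ → SatIn E S v ψ
  | v, .all i φ => ∀ a ∈ S, SatIn E S (Function.update v i a) φ
  | v, .ex i φ  => ∃ a ∈ S, SatIn E S (Function.update v i a) φ

/-- Satisfaction in the full structure `(N, E)`. -/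
def Sat {N : Type} (E : N → N → Prop) (v : ℕ → N) (φ : Fml) : Prop :=
  SatIn E Set.univ v φ

/-- Δ₀ (= Σ₀ = Π₀) formulas: every quantifier is bounded, i.e. of the form
`∀ x ∈ y` or `∃ x ∈ y`. -/
inductive IsDelta0 : Fml → Prop
  | mem (i j : ℕ) : IsDelta0 (Fml.mem i j)
  | eq (i j : ℕ)  : IsDelta0 (Fml.eq i j)
  | not {φ} : IsDelta0 φ → IsDelta0 φ.not
  | and {φ ψ} : IsDelta0 φ → IsDelta0 ψ → IsDelta0 (φ.and ψ)
  | or {φ ψ}  : IsDelta0 φ → IsDelta0 ψ → IsDelta0 (φ.or ψ)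
  | imp {φ ψ} : IsDelta0 φ → IsDelta0 ψ → IsDelta0 (φ.imp ψ)
  | ball {i j : ℕ} {φ} : i ≠ j → IsDelta0 φ →
      IsDelta0 (Fml.all i ((Fml.mem i j).imp φ))
  | bex {i j : ℕ} {φ} : i ≠ j → IsDelta0 φ →
      IsDelta0 (Fml.ex i ((Fml.mem i j).and φ))

/-- The Lévy hierarchy: `(levels n).1` is the class of Σ_n formulas and
`(levels n).2` the class of Π_n formulas. -/
def levels : ℕ → (Fml → Prop) × (Fml → Prop)
  | 0 => (IsDelta0, IsDelta0)
  | n + 1 =>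
      (fun φ => ∃ i ψ, (levels n).2 ψ ∧ φ = Fml.ex i ψ,
       fun φ => ∃ i ψ, (levels n).1 ψ ∧ φ = Fml.all i ψ)

def IsSigma (n : ℕ) : Fml → Prop := (levels n).1

def IsPi (n : ℕ) : Fml → Prop := (levels n).2

variable {M N : Type}

/-- `p` is the (Kuratowski) pair `{a, b}` in the sense of `E`. -/
def IsPairOf (E : M → M → Prop) (p a b : M) : Prop :=
  ∀ w, E w p ↔ (w = a ∨ w = b)

/-- `z` is the ordered pair `(a, b)` (Kuratowski) in the sense of `E`. -/
def IsOPairOf (E : M → M → Prop) (z a b : M) : Prop :=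
  ∃ s t, IsPairOf E s a a ∧ IsPairOf E t a b ∧ IsPairOf E z s t

/-- Valuation sending variable 0 to `x` and every other variable to `y`;
used for formulas φ(x, y) with free variables among {0, 1}. -/
def val2 (x y : M) : ℕ → M := fun k => if k = 0 then x else y

/-- Valuation sending 0 ↦ x, 1 ↦ y, everything else ↦ v;
used for formulas φ(x, y, v) with free variables among {0, 1, 2}. -/
def val3 (x y v : M) : ℕ → M := fun k => if k = 0 then x else if k = 1 then y else v

/-- `M ⊨ Sep(φ)` for φ = φ(x, v) (x is variable 0, v is variable 1):
∀v∀p∃q∀x(x∈q ↔ x∈p ∧ φ(x,v)). -/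
def SepAx (E : M → M → Prop) (φ : Fml) : Prop :=
  ∀ v p : M, ∃ q : M, ∀ x : M, E x q ↔ (E x p ∧ Sat E (val2 x v) φ)

/-- `M ⊨ Sep⁻(φ)` for a parameter-free φ = φ(x) (x is variable 0). -/
def SepMinusAx (E : M → M → Prop) (φ : Fml) : Prop :=
  ∀ p : M, ∃ q : M, ∀ x : M, E x q ↔ (E x p ∧ Sat E (fun _ => x) φ)

/-- `(M, E) ⊨ DB₀`: extensionality, empty set, pairing, union, cartesian
product, and Δ₀ separation. -/
def SatDB0 (E : M → M → Prop) : Prop :=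
  (∀ a b : M, (∀ x, E x a ↔ E x b) → a = b) ∧
  (∃ e : M, ∀ x, ¬ E x e) ∧
  (∀ a b : M, ∃ p, IsPairOf E p a b) ∧
  (∀ a : M, ∃ u, ∀ x, E x u ↔ ∃ y, E y a ∧ E x y) ∧
  (∀ a b : M, ∃ c, ∀ z, E z c ↔ ∃ x y, E x a ∧ E y b ∧ IsOPairOf E z x y) ∧
  (∀ φ, IsDelta0 φ → φ.fv ⊆ {0, 1} → SepAx E φ)

/-- `M ⊨ Coll(φ)` for φ = φ(x, y, v) (x = var 0, y = var 1, v = var 2):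
∀v∀p(∀x∈p ∃y φ → ∃q ∀x∈p ∃y∈q φ). -/
def CollAx (E : M → M → Prop) (φ : Fml) : Prop :=
  ∀ v p : M, (∀ x, E x p → ∃ y, Sat E (val3 x y v) φ) →
    ∃ q, ∀ x, E x p → ∃ y, E y q ∧ Sat E (val3 x y v) φ

/-- `M ⊨ Coll_s(φ)`: ∀v∀p∃q∀x∈p(∃y φ ↔ ∃y∈q φ). -/
def CollSAx (E : M → M → Prop) (φ : Fml) : Prop :=
  ∀ v p : M, ∃ q, ∀ x, E x p →
    ((∃ y, Sat E (val3 x y v) φ) ↔ ∃ y, E y q ∧ Sat E (val3 x y v) φ)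

/-- `M ⊨ Coll_w(φ)`: ∀v(∀x∃y φ → ∀p∃q∀x∈p∃y∈q φ). -/
def CollWAx (E : M → M → Prop) (φ : Fml) : Prop :=
  ∀ v : M, (∀ x, ∃ y, Sat E (val3 x y v) φ) →
    ∀ p, ∃ q, ∀ x, E x p → ∃ y, E y q ∧ Sat E (val3 x y v) φ

/-- `M ⊨ Coll⁻(φ)` for a parameter-free φ = φ(x, y) (x = var 0, y = var 1). -/
def CollMinusAx (E : M → M → Prop) (φ : Fml) : Prop :=
  ∀ p : M, (∀ x, E x p → ∃ y, Sat E (val2 x y) φ) →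
    ∃ q, ∀ x, E x p → ∃ y, E y q ∧ Sat E (val2 x y) φ

/-- `M ⊨ Coll_w⁻(φ)` for a parameter-free φ = φ(x, y). -/
def CollWMinusAx (E : M → M → Prop) (φ : Fml) : Prop :=
  (∀ x : M, ∃ y, Sat E (val2 x y) φ) →
    ∀ p, ∃ q, ∀ x, E x p → ∃ y, E y q ∧ Sat E (val2 x y) φ

/-- `M ⊨ Coll_s⁻(φ)` for a parameter-free φ = φ(x, y). -/
def CollSMinusAx (E : M → M → Prop) (φ : Fml) : Prop :=
  ∀ p : M, ∃ q, ∀ x, E x p →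
    ((∃ y, Sat E (val2 x y) φ) ↔ ∃ y, E y q ∧ Sat E (val2 x y) φ)

/- Schemas over a class Γ of formulas. -/

def CollScheme (E : M → M → Prop) (Γ : Fml → Prop) : Prop :=
  ∀ φ, Γ φ → φ.fv ⊆ {0, 1, 2} → CollAx E φ

def CollSScheme (E : M → M → Prop) (Γ : Fml → Prop) : Prop :=
  ∀ φ, Γ φ → φ.fv ⊆ {0, 1, 2} → CollSAx E φ

def CollWScheme (E : M → M → Prop) (Γ : Fml → Prop) : Prop :=
  ∀ φ, Γ φ → φ.fv ⊆ {0, 1, 2} → CollWAx E φ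

def CollMinusScheme (E : M → M → Prop) (Γ : Fml → Prop) : Prop :=
  ∀ φ, Γ φ → φ.fv ⊆ {0, 1} → CollMinusAx E φ

def CollWMinusScheme (E : M → M → Prop) (Γ : Fml → Prop) : Prop :=
  ∀ φ, Γ φ → φ.fv ⊆ {0, 1} → CollWMinusAx E φ

def CollSMinusScheme (E : M → M → Prop) (Γ : Fml → Prop) : Prop :=
  ∀ φ, Γ φ → φ.fv ⊆ {0, 1} → CollSMinusAx E φ

def SepScheme (E : M → M → Prop) (Γ : Fml → Prop) : Prop :=
  ∀ φ, Γ φ → φ.fv ⊆ {0, 1} → SepAx E φ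

def SepMinusScheme (E : M → M → Prop) (Γ : Fml → Prop) : Prop :=
  ∀ φ, Γ φ → φ.fv ⊆ {0} → SepMinusAx E φ

/- Extensions. We present an extension `M ⊆ N` by an embedding `f : M → N`. -/

/-- `f` embeds `(M, EM)` as a substructure of `(N, EN)`. -/
def SubStr (EM : M → M → Prop) (EN : N → N → Prop) (f : M → N) : Prop :=
  Function.Injective f ∧ ∀ a b : M, EM a b ↔ EN (f a) (f b)

/-- `f : M → N` is a (fully) elementary embedding. -/
def ElemEmb (EM : M → M → Prop) (EN : N → N → Prop) (f : M → N) : Prop :=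
  ∀ (φ : Fml) (v : ℕ → M), Sat EM v φ ↔ Sat EN (f ∘ v) φ

/-- `f : M → N` is a Σ_n-elementary embedding (M ≺_{Σ_n} N). -/
def SigmaElemEmb (n : ℕ) (EM : M → M → Prop) (EN : N → N → Prop) (f : M → N) : Prop :=
  ∀ φ, IsSigma n φ → ∀ v : ℕ → M, Sat EM v φ ↔ Sat EN (f ∘ v) φ

/-- `f : M → N` is a Δ₀-elementary embedding (M ≺_{Δ₀} N). -/
def Delta0ElemEmb (EM : M → M → Prop) (EN : N → N → Prop) (f : M → N) : Prop :=
  ∀ φ, IsDelta0 φ → ∀ v : ℕ → M, Sat EM v φ ↔ Sat EN (f ∘ v) φ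

/-- The convex hull M* of (the image of) M in N:
{a ∈ N : N ⊨ a ∈ m for some m ∈ M}. -/
def hull (EN : N → N → Prop) (f : M → N) : Set N := {a | ∃ m : M, EN a (f m)}

/-- The substructure of `N` with domain `S` is a Σ_n-elementary substructure of
`N` (S ≺_{Σ_n} N). -/
def SigmaElemInTop (n : ℕ) (EN : N → N → Prop) (S : Set N) : Prop :=
  ∀ φ, IsSigma n φ → ∀ v : ℕ → N, (∀ k, v k ∈ S) → (SatIn EN S v φ ↔ Sat EN v φ)

/-- The substructure of `N` with domain `S` is a fully elementary substructure. -/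
def ElemInTop (EN : N → N → Prop) (S : Set N) : Prop :=
  ∀ (φ : Fml) (v : ℕ → N), (∀ k, v k ∈ S) → (SatIn EN S v φ ↔ Sat EN v φ)

/-- `f` is a Σ_n-elementary embedding of `M` into the substructure of `N` with
domain `S` (e.g. M ≺_{Σ_n} M*). -/
def SigmaElemEmbInto (n : ℕ) (EM : M → M → Prop) (EN : N → N → Prop) (f : M → N)
    (S : Set N) : Prop :=
  ∀ φ, IsSigma n φ → ∀ v : ℕ → M, Sat EM v φ ↔ SatIn EN S (f ∘ v) φ

/-- `f` is a fully elementary embedding of `M` into the substructure of `N`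
with domain `S`. -/
def ElemEmbInto (EM : M → M → Prop) (EN : N → N → Prop) (f : M → N) (S : Set N) : Prop :=
  ∀ (φ : Fml) (v : ℕ → M), Sat EM v φ ↔ SatIn EN S (f ∘ v) φ

/-- The extension presented by `f` is an end extension. -/
def IsEndEmb (EN : N → N → Prop) (f : M → N) : Prop :=
  ∀ (m : M) (a : N), EN a (f m) → ∃ m', f m' = a

/-- The extension presented by `f` is cofinal. -/
def Cofinal (EN : N → N → Prop) (f : M → N) : Prop :=
  ∀ a : N, ∃ m : M, EN a (f m)

/-- `a` is a transitive set in the sense of `(N, EN)`. -/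
def TransIn (EN : N → N → Prop) (a : N) : Prop :=
  ∀ x, EN x a → ∀ y, EN y x → EN y a

/-- The extension presented by `f` is taller. -/
def Taller (EN : N → N → Prop) (f : M → N) : Prop :=
  ∃ a : N, ∀ m : M, EN (f m) a

/-- The extension presented by `f` is taller*. -/
def TallerStar (EN : N → N → Prop) (f : M → N) : Prop :=
  ∃ a : N, (∀ m : M, EN (f m) a) ∧ TransIn EN a

/-- Property end_n: for every elementary extension N of M, M* ≺_{Σ_n} N. -/
def HasEnd (n : ℕ) (EM : M → M → Prop) : Prop :=
  ∀ (N : Type) (EN : N → N → Prop) (f : M → N), ElemEmb EM EN f →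
    SigmaElemInTop n EN (hull EN f)

/-- Property cof_n: for every elementary extension N of M, M ≺_{Σ_n} M*. -/
def HasCof (n : ℕ) (EM : M → M → Prop) : Prop :=
  ∀ (N : Type) (EN : N → N → Prop) (f : M → N), ElemEmb EM EN f →
    SigmaElemEmbInto n EM EN f (hull EN f)

/-- Property COF_n: for every Δ₀-elementary cofinal extension N of M with
N ⊨ DB₀, M ≺_{Σ_n} N. -/
def HasCOF (n : ℕ) (EM : M → M → Prop) : Prop :=
  ∀ (N : Type) (EN : N → N → Prop) (f : M → N), SatDB0 EN →
    Delta0ElemEmb EM EN f → Cofinal EN f → SigmaElemEmb n EM EN f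

/-- TCo: every set is an element of some transitive set. -/
def SatTCo (E : M → M → Prop) : Prop :=
  ∀ a : M, ∃ t, E a t ∧ TransIn E t

/-- `a` is an ordinal in the sense of `(M, E)`: a transitive set linearly
ordered by `E`. -/
def OrdIn (E : M → M → Prop) (a : M) : Prop :=
  TransIn E a ∧ ∀ x y, E x a → E y a → (E x y ∨ x = y ∨ E y x)

/-- The formula φ(p, α, v) (p = var 0, α = var 1, v = var 2), with parameter
`v ∈ M`, defines a resolution on `(M, E)`. -/
def IsResolution (E : M → M → Prop) (φ : Fml) (v : M) : Prop :=
  φ.fv ⊆ {0, 1, 2} ∧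
  (∀ α, OrdIn E α → ∃! p, Sat E (val3 p α v) φ) ∧
  (∀ α β p q, E α β → Sat E (val3 p α v) φ → Sat E (val3 q β v) φ →
    ∀ x, E x p → E x q) ∧
  (∀ x, ∃ α, OrdIn E α ∧ ∀ p, Sat E (val3 p α v) φ → E x p)

end FOSet

namespace FOSet

/-! ### Formulas: countability, free variables and satisfaction -/

namespace Fml

/-- An injective numerical code for formulas. -/
def code : Fml → ℕ
  | mem i j => Nat.pair 0 (Nat.pair i j)
  | eq i j  => Nat.pair 1 (Nat.pair i j)
  | not φ   => Nat.pair 2 φ.code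
  | and φ ψ => Nat.pair 3 (Nat.pair φ.code ψ.code)
  | or φ ψ  => Nat.pair 4 (Nat.pair φ.code ψ.code)
  | imp φ ψ => Nat.pair 5 (Nat.pair φ.code ψ.code)
  | all i φ => Nat.pair 6 (Nat.pair i φ.code)
  | ex i φ  => Nat.pair 7 (Nat.pair i φ.code)

theorem code_injective : Function.Injective code := by
  intro φ
  induction φ with
  | mem i j | eq i j => intro ψ h; cases ψ <;> simp_all [code, Nat.pair_eq_pair]
  | not φ ih =>
    intro ψ h
    cases ψ <;> simp [code, Nat.pair_eq_pair] at h ⊢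
    exact ih h
  | and φ χ ih ih' | or φ χ ih ih' | imp φ χ ih ih' =>
    intro ψ h
    cases ψ <;> simp [code, Nat.pair_eq_pair] at h ⊢
    exact ⟨ih h.1, ih' h.2⟩
  | all i φ ih | ex i φ ih =>
    intro ψ h
    cases ψ <;> simp [code, Nat.pair_eq_pair] at h ⊢
    exact ⟨h.1, ih h.2⟩

instance : Countable Fml := code_injective.countable

theorem fv_finite (φ : Fml) : φ.fv.Finite := by
  induction φ with
  | mem i j | eq i j => simp [fv]
  | not φ ih => exact ih
  | and φ ψ ih ih' | or φ ψ ih ih' | imp φ ψ ih ih' => exact ih.union ih'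
  | all i φ ih | ex i φ ih => exact ih.sdiff

theorem exists_fv_bound (φ : Fml) : ∃ B, ∀ l ∈ φ.fv, l < B := by
  obtain ⟨b, hb⟩ := φ.fv_finite.bddAbove
  exact ⟨b + 1, fun l hl => Nat.lt_succ_of_le (hb hl)⟩

end Fml

section Sat

variable {E : M → M → Prop} {v : ℕ → M}

@[simp] theorem sat_mem {i j : ℕ} : Sat E v (.mem i j) ↔ E (v i) (v j) := Iff.rfl
@[simp] theorem sat_eq {i j : ℕ} : Sat E v (.eq i j) ↔ v i = v j := Iff.rfl
@[simp] theorem sat_not {φ : Fml} : Sat E v φ.not ↔ ¬ Sat E v φ := Iff.rfl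
@[simp] theorem sat_and {φ ψ : Fml} : Sat E v (φ.and ψ) ↔ Sat E v φ ∧ Sat E v ψ := Iff.rfl
@[simp] theorem sat_or {φ ψ : Fml} : Sat E v (φ.or ψ) ↔ Sat E v φ ∨ Sat E v ψ := Iff.rfl
@[simp] theorem sat_imp {φ ψ : Fml} : Sat E v (φ.imp ψ) ↔ (Sat E v φ → Sat E v ψ) := Iff.rfl

@[simp] theorem sat_all {i : ℕ} {φ : Fml} :
    Sat E v (.all i φ) ↔ ∀ a, Sat E (Function.update v i a) φ := by
  simp [Sat, SatIn]

@[simp] theorem sat_ex {i : ℕ} {φ : Fml} :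
    Sat E v (.ex i φ) ↔ ∃ a, Sat E (Function.update v i a) φ := by
  simp [Sat, SatIn]

theorem sat_congr {E : M → M → Prop} {φ : Fml} :
    ∀ {v w : ℕ → M}, (∀ l ∈ φ.fv, v l = w l) → (Sat E v φ ↔ Sat E w φ) := by
  have upd {φ : Fml} {i : ℕ} {v w : ℕ → M} (h : ∀ l ∈ φ.fv \ {i}, v l = w l) (a : M) :
      ∀ l ∈ φ.fv, Function.update v i a l = Function.update w i a l := by
    intro l hl
    by_cases hi : l = i
    · simp [hi]
    · simpa [hi] using h l ⟨hl, hi⟩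
  induction φ with
  | mem i j | eq i j => intro v w h; simp [h i (by simp [Fml.fv]), h j (by simp [Fml.fv])]
  | not φ ih => intro v w h; exact not_congr (ih h)
  | and φ ψ ih ih' =>
    intro v w h
    exact and_congr (ih fun l hl => h l (.inl hl)) (ih' fun l hl => h l (.inr hl))
  | or φ ψ ih ih' =>
    intro v w h
    exact or_congr (ih fun l hl => h l (.inl hl)) (ih' fun l hl => h l (.inr hl))
  | imp φ ψ ih ih' =>
    intro v w h
    exact imp_congr (ih fun l hl => h l (.inl hl)) (ih' fun l hl => h l (.inr hl))
  | all i φ ih =>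
    intro v w h
    simp only [sat_all]
    exact forall_congr' fun a => ih (upd h a)
  | ex i φ ih =>
    intro v w h
    simp only [sat_ex]
    exact exists_congr fun a => ih (upd h a)

/-- Renaming the free variables of a Δ₀ formula. -/
theorem IsDelta0.exists_rename (E : M → M → Prop) {φ : Fml} (hφ : IsDelta0 φ) :
    ∀ (ρ : ℕ → ℕ) (C : ℕ), (∀ l ∈ φ.fv, ρ l < C) →
      ∃ φ', IsDelta0 φ' ∧ (∀ l ∈ φ'.fv, l < C) ∧ ∀ v, Sat E v φ' ↔ Sat E (v ∘ ρ) φ := by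
  have lift {i j : ℕ} {φ : Fml} {ρ : ℕ → ℕ} {C : ℕ}
      (h : ∀ l ∈ (({i, j} : Set ℕ) ∪ φ.fv) \ {i}, ρ l < C) :
      ∀ l ∈ φ.fv, Function.update ρ i C l < C + 1 := by
    intro l hl
    by_cases hi : l = i
    · simp [hi]
    · simpa [hi] using (h l ⟨.inr hl, hi⟩).trans (Nat.lt_succ_self C)
  have comp {i j : ℕ} {φ : Fml} {ρ : ℕ → ℕ} {C : ℕ}
      (h : ∀ l ∈ (({i, j} : Set ℕ) ∪ φ.fv) \ {i}, ρ l < C) (v : ℕ → M) (a : M) :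
      Sat E (Function.update v C a ∘ Function.update ρ i C) φ ↔
        Sat E (Function.update (v ∘ ρ) i a) φ := by
    refine sat_congr fun l hl => ?_
    by_cases hi : l = i
    · simp [hi]
    · simp [hi, (h l ⟨.inr hl, hi⟩).ne]
  have bound {j C : ℕ} {φ : Fml} (hj : j < C) (h : ∀ l ∈ φ.fv, l < C + 1) :
      ∀ l ∈ (({C, j} : Set ℕ) ∪ φ.fv) \ {C}, l < C := by
    rintro l ⟨(rfl | rfl) | hl, hne⟩
    · exact absurd rfl hne
    · exact hj
    · exact lt_of_le_of_ne (Nat.lt_succ_iff.1 (h l hl)) hne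
  induction hφ with
  | mem i j =>
    intro ρ C h
    refine ⟨.mem (ρ i) (ρ j), .mem _ _, ?_, fun v => Iff.rfl⟩
    rintro l (rfl | rfl)
    exacts [h i (.inl rfl), h j (.inr rfl)]
  | eq i j =>
    intro ρ C h
    refine ⟨.eq (ρ i) (ρ j), .eq _ _, ?_, fun v => Iff.rfl⟩
    rintro l (rfl | rfl)
    exacts [h i (.inl rfl), h j (.inr rfl)]
  | not _ ih =>
    intro ρ C h
    obtain ⟨φ', h1, h2, h3⟩ := ih ρ C h
    exact ⟨φ'.not, h1.not, h2, fun v => not_congr (h3 v)⟩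
  | and _ _ ih ih' =>
    intro ρ C h
    obtain ⟨φ', h1, h2, h3⟩ := ih ρ C fun l hl => h l (.inl hl)
    obtain ⟨ψ', k1, k2, k3⟩ := ih' ρ C fun l hl => h l (.inr hl)
    exact ⟨φ'.and ψ', h1.and k1, fun l hl => hl.elim (h2 l) (k2 l),
      fun v => and_congr (h3 v) (k3 v)⟩
  | or _ _ ih ih' =>
    intro ρ C h
    obtain ⟨φ', h1, h2, h3⟩ := ih ρ C fun l hl => h l (.inl hl)
    obtain ⟨ψ', k1, k2, k3⟩ := ih' ρ C fun l hl => h l (.inr hl)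
    exact ⟨φ'.or ψ', h1.or k1, fun l hl => hl.elim (h2 l) (k2 l),
      fun v => or_congr (h3 v) (k3 v)⟩
  | imp _ _ ih ih' =>
    intro ρ C h
    obtain ⟨φ', h1, h2, h3⟩ := ih ρ C fun l hl => h l (.inl hl)
    obtain ⟨ψ', k1, k2, k3⟩ := ih' ρ C fun l hl => h l (.inr hl)
    exact ⟨φ'.imp ψ', h1.imp k1, fun l hl => hl.elim (h2 l) (k2 l),
      fun v => imp_congr (h3 v) (k3 v)⟩
  | @ball i j φ hij _ ih =>
    intro ρ C h
    have hj : ρ j < C := h j ⟨.inl (.inr rfl), hij.symm⟩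
    obtain ⟨φ', h1, h2, h3⟩ := ih (Function.update ρ i C) (C + 1) (lift h)
    refine ⟨.all C ((Fml.mem C (ρ j)).imp φ'), .ball hj.ne' h1, bound hj h2, fun v => ?_⟩
    simp [h3, comp h, hj.ne, hij.symm]
  | @bex i j φ hij _ ih =>
    intro ρ C h
    have hj : ρ j < C := h j ⟨.inl (.inr rfl), hij.symm⟩
    obtain ⟨φ', h1, h2, h3⟩ := ih (Function.update ρ i C) (C + 1) (lift h)
    refine ⟨.ex C ((Fml.mem C (ρ j)).and φ'), .bex hj.ne' h1, bound hj h2, fun v => ?_⟩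
    simp [h3, comp h, hj.ne, hij.symm]

end Sat

/-! ### Definable predicates of valuations -/

/-- The valuation `a, v 0, v 1, …`. -/
def scons (a : M) (v : ℕ → M) : ℕ → M
  | 0 => a
  | l + 1 => v l

@[simp] theorem scons_zero (a : M) (v : ℕ → M) : scons a v 0 = a := rfl
@[simp] theorem scons_succ (a : M) (v : ℕ → M) (l : ℕ) : scons a v (l + 1) = v l := rfl

/-- Extension of a renaming of variables under a binder. -/
def liftRen (ρ : ℕ → ℕ) : ℕ → ℕ
  | 0 => 0
  | l + 1 => ρ l + 1

theorem scons_comp (a : M) (v : ℕ → M) (ρ : ℕ → ℕ) :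
    scons a (v ∘ ρ) = scons a v ∘ liftRen ρ := by
  funext l; cases l <;> rfl

theorem liftRen_lt {ρ : ℕ → ℕ} {B C : ℕ} (h : ∀ l < B, ρ l < C) :
    ∀ l < B + 1, liftRen ρ l < C + 1 := by
  rintro (_ | l) hl
  · exact Nat.succ_pos C
  · exact Nat.succ_lt_succ (h l (Nat.lt_of_succ_lt_succ hl))

/-- `P` is defined by a Δ₀ formula in the variables below `B`. -/
def DefD0 (E : M → M → Prop) (B : ℕ) (P : (ℕ → M) → Prop) : Prop :=
  ∃ φ, IsDelta0 φ ∧ (∀ l ∈ φ.fv, l < B) ∧ ∀ v, P v ↔ Sat E v φ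

namespace DefD0

variable {E : M → M → Prop} {B C : ℕ} {P P' Q : (ℕ → M) → Prop}

theorem mem {i j : ℕ} (hi : i < B) (hj : j < B) : DefD0 E B fun v => E (v i) (v j) :=
  ⟨.mem i j, .mem i j, by rintro l (rfl | rfl) <;> assumption, fun _ => Iff.rfl⟩

theorem eq {i j : ℕ} (hi : i < B) (hj : j < B) : DefD0 E B fun v => v i = v j :=
  ⟨.eq i j, .eq i j, by rintro l (rfl | rfl) <;> assumption, fun _ => Iff.rfl⟩

theorem not (h : DefD0 E B P) : DefD0 E B fun v => ¬ P v := by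
  obtain ⟨φ, h1, h2, h3⟩ := h
  exact ⟨φ.not, h1.not, h2, fun v => not_congr (h3 v)⟩

theorem and (h : DefD0 E B P) (k : DefD0 E B Q) : DefD0 E B fun v => P v ∧ Q v := by
  obtain ⟨φ, h1, h2, h3⟩ := h
  obtain ⟨ψ, k1, k2, k3⟩ := k
  exact ⟨φ.and ψ, h1.and k1, fun l hl => hl.elim (h2 l) (k2 l), fun v => and_congr (h3 v) (k3 v)⟩

theorem or (h : DefD0 E B P) (k : DefD0 E B Q) : DefD0 E B fun v => P v ∨ Q v := by
  obtain ⟨φ, h1, h2, h3⟩ := h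
  obtain ⟨ψ, k1, k2, k3⟩ := k
  exact ⟨φ.or ψ, h1.or k1, fun l hl => hl.elim (h2 l) (k2 l), fun v => or_congr (h3 v) (k3 v)⟩

theorem congr (h : DefD0 E B P) (e : ∀ v, P' v ↔ P v) : DefD0 E B P' := by
  obtain rfl : P' = P := funext fun v => propext (e v)
  exact h

theorem rename (h : DefD0 E B P) {ρ : ℕ → ℕ} (hρ : ∀ l < B, ρ l < C)
    (e : ∀ v, P' v ↔ P (v ∘ ρ)) : DefD0 E C P' := by
  obtain ⟨φ, h1, h2, h3⟩ := h
  obtain ⟨φ', k1, k2, k3⟩ := h1.exists_rename E ρ C fun l hl => hρ l (h2 l hl)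
  exact ⟨φ', k1, k2, fun v => by rw [e, h3, k3]⟩

theorem supp (h : DefD0 E B P) {v w : ℕ → M} (hvw : ∀ l < B, v l = w l) : P v ↔ P w := by
  obtain ⟨φ, -, h2, h3⟩ := h
  rw [h3, h3]
  exact sat_congr fun l hl => hvw l (h2 l hl)

/-- The renaming that turns the variable `0` of a predicate into the variable `B`. -/
def toLast (B : ℕ) : ℕ → ℕ
  | 0 => B
  | l + 1 => l

theorem toLast_lt : ∀ l < B + 1, toLast B l < B + 1 := by
  rintro (_ | l) hl <;> simp only [toLast] <;> omega

theorem update_comp_toLast (v : ℕ → M) (a : M) :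
    ∀ l < B + 1, (Function.update v B a ∘ toLast B) l = scons a v l := by
  rintro (_ | l) hl
  · simp [toLast]
  · have : l ≠ B := by omega
    simp [toLast, this]

theorem bex {i : ℕ} (hi : i < B) (h : DefD0 E (B + 1) Q) :
    DefD0 E B fun v => ∃ a, E a (v i) ∧ Q (scons a v) := by
  obtain ⟨φ, h1, h2, h3⟩ := h.rename toLast_lt fun _ => Iff.rfl
  refine ⟨.ex B ((Fml.mem B i).and φ), .bex hi.ne' h1, ?_, fun v => ?_⟩
  · rintro l ⟨(rfl | rfl) | hl, hne⟩
    · exact absurd rfl hne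
    · exact hi
    · exact lt_of_le_of_ne (Nat.lt_succ_iff.1 (h2 l hl)) hne
  · simp only [sat_ex, sat_and, sat_mem, ← h3, Function.update_self,
      Function.update_of_ne hi.ne]
    exact exists_congr fun a => and_congr_right fun _ => (h.supp (update_comp_toLast v a)).symm

theorem ball {i : ℕ} (hi : i < B) (h : DefD0 E (B + 1) Q) :
    DefD0 E B fun v => ∀ a, E a (v i) → Q (scons a v) :=
  (bex hi h.not).not.congr fun v => by simp

theorem isPairOf {p a b : ℕ} (hp : p < B) (ha : a < B) (hb : b < B) :
    DefD0 E B fun v => IsPairOf E (v p) (v a) (v b) := by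
  refine (((mem ha hp).and (mem hb hp)).and (ball hp
    (Q := fun w => w 0 = w (a + 1) ∨ w 0 = w (b + 1))
    ((eq (by omega) (by omega)).or (eq (by omega) (by omega))))).congr fun v => ?_
  simp only [IsPairOf, scons_zero, scons_succ]
  constructor
  · intro h
    exact ⟨⟨(h _).2 (.inl rfl), (h _).2 (.inr rfl)⟩, fun w => (h w).1⟩
  · rintro ⟨⟨h1, h2⟩, h3⟩ w
    exact ⟨h3 w, by rintro (rfl | rfl) <;> assumption⟩

theorem isOPairOf {z a b : ℕ} (hz : z < B) (ha : a < B) (hb : b < B) :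
    DefD0 E B fun v => IsOPairOf E (v z) (v a) (v b) := by
  refine (bex hz (bex (i := z + 1) (by omega) (Q := fun w =>
    IsPairOf E (w 1) (w (a + 2)) (w (a + 2)) ∧ IsPairOf E (w 0) (w (a + 2)) (w (b + 2)) ∧
      IsPairOf E (w (z + 2)) (w 1) (w 0))
    ((isPairOf ?_ ?_ ?_).and ((isPairOf ?_ ?_ ?_).and (isPairOf ?_ ?_ ?_))))).congr fun v => ?_
  any_goals omega
  constructor
  · rintro ⟨s, t, h1, h2, h3⟩
    exact ⟨s, (h3 s).2 (.inl rfl), t, (h3 t).2 (.inr rfl), h1, h2, h3⟩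
  · rintro ⟨s, -, t, -, h1, h2, h3⟩
    exact ⟨s, t, h1, h2, h3⟩

theorem transIn {i : ℕ} (hi : i < B) : DefD0 E B fun v => TransIn E (v i) :=
  (ball hi (ball (i := 0) (by omega) (mem (i := 0) (j := i + 2) (by omega) (by omega)))).congr
    fun _ => Iff.rfl

/-- Unbounded quantification over the two components of an ordered pair is bounded. -/
theorem exists_isOPairOf {z : ℕ} (hz : z < B) (h : DefD0 E (B + 2) Q) :
    DefD0 E B fun v => ∃ a b, IsOPairOf E (v z) a b ∧ Q (scons b (scons a v)) := by
  have hQ : DefD0 E (B + 4) fun w => IsOPairOf E (w (z + 4)) (w 1) (w 0) ∧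
      Q (w ∘ fun l => if l < 2 then l else l + 2) :=
    (isOPairOf (by omega) (by omega) (by omega)).and
      (h.rename (fun l hl => by split_ifs <;> omega) fun _ => Iff.rfl)
  refine (bex hz (bex (i := z + 1) (by omega)
    (bex (i := 1) (by omega) (bex (i := 1) (by omega) hQ)))).congr fun v => ?_
  have key (s t a b : M) : (scons b (scons a (scons t (scons s v))) ∘
      fun l => if l < 2 then l else l + 2) = scons b (scons a v) := by
    funext l
    rcases l with _ | _ | l <;> simp
  simp only [key]
  constructor
  · rintro ⟨a, b, ⟨s, t, h1, h2, h3⟩, h4⟩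
    exact ⟨s, (h3 s).2 (.inl rfl), t, (h3 t).2 (.inr rfl), a, (h1 a).2 (.inl rfl), b,
      (h2 b).2 (.inr rfl), ⟨s, t, h1, h2, h3⟩, h4⟩
  · rintro ⟨s, -, t, -, a, -, b, -, h⟩
    exact ⟨a, b, h⟩

end DefD0

/-! ### The Lévy hierarchy of definable predicates -/

/-- `P` is Σ_j-definable in the variables below `B`. -/
def SigD (E : M → M → Prop) : ℕ → ℕ → ((ℕ → M) → Prop) → Prop
  | 0, B, P => DefD0 E B P
  | j + 1, B, P => ∃ Q, SigD E j (B + 1) Q ∧ ∀ v, P v ↔ ∃ a, ¬ Q (scons a v)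

/-- Kuratowski pairing is total and injective. -/
structure HasPairing (E : M → M → Prop) : Prop where
  exists_pair : ∀ a b, ∃ z, IsOPairOf E z a b
  inj : ∀ {z a b a' b'}, IsOPairOf E z a b → IsOPairOf E z a' b' → a = a' ∧ b = b'

theorem SatDB0.hasPairing {E : M → M → Prop} (h : SatDB0 E) : HasPairing E := by
  obtain ⟨hext, -, hpair, -⟩ := h
  have uniq {s s' a b : M} (h1 : IsPairOf E s a b) (h2 : IsPairOf E s' a b) : s = s' :=
    hext _ _ fun x => (h1 x).trans (h2 x).symm
  refine ⟨fun a b => ?_, ?_⟩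
  · obtain ⟨s, hs⟩ := hpair a a
    obtain ⟨t, ht⟩ := hpair a b
    obtain ⟨z, hz⟩ := hpair s t
    exact ⟨z, s, t, hs, ht, hz⟩
  · rintro z a b a' b' ⟨s, t, hs, ht, hz⟩ ⟨s', t', hs', ht', hz'⟩
    have hst (w : M) : (w = s ∨ w = t) ↔ (w = s' ∨ w = t') := (hz w).symm.trans (hz' w)
    have sing {u x y : M} (h : IsPairOf E u x x) (hy : E y u) : y = x := by
      simpa using (h y).1 hy
    have ha : a = a' := by
      rcases (hst s).1 (.inl rfl) with h | h
      · exact sing hs' (h ▸ (hs a).2 (.inl rfl))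
      · exact (sing hs (h ▸ (ht' a').2 (.inl rfl))).symm
    subst ha
    have hss : s = s' := uniq hs hs'
    subst hss
    refine ⟨rfl, ?_⟩
    have htt : t = t' := by
      have h1 := (hst t).1 (.inr rfl)
      have h2 := (hst t').2 (.inr rfl)
      rcases h1 with h1 | h1
      · rcases h2 with h2 | h2
        · exact h1.trans h2.symm
        · exact h2.symm
      · exact h1
    subst htt
    have h1 := (ht' b).1 ((ht b).2 (.inr rfl))
    have h2 := (ht b').1 ((ht' b').2 (.inr rfl))
    rcases h1 with h1 | h1
    · rcases h2 with h2 | h2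
      · exact h1.trans h2.symm
      · exact h2.symm
    · exact h1

namespace SigD

variable {E : M → M → Prop} {j B C : ℕ} {P P' Q : (ℕ → M) → Prop}

theorem congr (h : SigD E j B P) (e : ∀ v, P' v ↔ P v) : SigD E j B P' := by
  obtain rfl : P' = P := funext fun v => propext (e v)
  exact h

theorem rename (h : SigD E j B P) {ρ : ℕ → ℕ} (hρ : ∀ l < B, ρ l < C)
    (e : ∀ v, P' v ↔ P (v ∘ ρ)) : SigD E j C P' := by
  induction j generalizing B C P P' ρ with
  | zero => exact DefD0.rename h hρ e
  | succ j ih =>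
    obtain ⟨Q, hQ, hPQ⟩ := h
    refine ⟨fun w => Q (w ∘ liftRen ρ), ih hQ (liftRen_lt hρ) fun _ => Iff.rfl, fun v => ?_⟩
    simp only [e, hPQ, scons_comp]

theorem mono (h : SigD E j B P) (hBC : B ≤ C) : SigD E j C P :=
  h.rename (ρ := id) (fun _ hl => hl.trans_le hBC) fun _ => Iff.rfl

theorem supp (h : SigD E j B P) {v w : ℕ → M} (hvw : ∀ l < B, v l = w l) : P v ↔ P w := by
  induction j generalizing B P v w with
  | zero => exact DefD0.supp h hvw
  | succ j ih =>
    obtain ⟨Q, hQ, hPQ⟩ := h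
    rw [hPQ, hPQ]
    refine exists_congr fun a => not_congr (ih hQ ?_)
    rintro (_ | l) hl
    · rfl
    · exact hvw l (Nat.lt_of_succ_lt_succ hl)

/-- Σ_j-definable predicates, and their negations, are defined by Σ_j and Π_j formulas. -/
theorem exists_formula (h : SigD E j B P) :
    (∃ φ, IsSigma j φ ∧ (∀ l ∈ φ.fv, l < B) ∧ ∀ v, P v ↔ Sat E v φ) ∧
    (∃ φ, IsPi j φ ∧ (∀ l ∈ φ.fv, l < B) ∧ ∀ v, ¬ P v ↔ Sat E v φ) := by
  induction j generalizing B P with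
  | zero => exact ⟨h, DefD0.not h⟩
  | succ j ih =>
    obtain ⟨Q, hQ, hPQ⟩ := h
    have hfv {φ : Fml} (h : ∀ l ∈ φ.fv, l < B + 1) : ∀ l ∈ φ.fv \ {B}, l < B :=
      fun l hl => lt_of_le_of_ne (Nat.lt_succ_iff.1 (h l hl.1)) hl.2
    have hsupp (v : ℕ → M) (a : M) := hQ.supp (DefD0.update_comp_toLast v a)
    obtain ⟨⟨φ, h1, h2, h3⟩, ⟨ψ, k1, k2, k3⟩⟩ :=
      ih (hQ.rename DefD0.toLast_lt fun _ => Iff.rfl)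
    refine ⟨⟨.ex B ψ, ⟨B, ψ, k1, rfl⟩, hfv k2, fun v => ?_⟩,
      ⟨.all B φ, ⟨B, φ, h1, rfl⟩, hfv h2, fun v => ?_⟩⟩
    · simp only [sat_ex, ← k3, hsupp, hPQ]
    · simp only [sat_all, ← h3, hsupp, hPQ, not_exists, not_not]

variable [Nonempty M]

theorem not_succ (h : SigD E j B P) : SigD E (j + 1) B fun v => ¬ P v :=
  ⟨fun w => P (w ∘ Nat.succ), h.rename (fun _ hl => Nat.succ_lt_succ hl) fun _ => Iff.rfl,
    fun _ => (exists_const M).symm⟩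

theorem succ (h : SigD E j B P) : SigD E (j + 1) B P := by
  induction j generalizing B P with
  | zero => exact (not_succ (j := 0) (DefD0.not h)).congr fun v => by simp
  | succ j ih =>
    obtain ⟨Q, hQ, hPQ⟩ := h
    exact ⟨Q, ih hQ, hPQ⟩

theorem mono_level {k : ℕ} (hjk : j ≤ k) (h : SigD E j B P) : SigD E k B P := by
  induction hjk with
  | refl => exact h
  | step _ ih => exact ih.succ

theorem of_defD0 (h : DefD0 E B P) : SigD E j B P := mono_level (j := 0) (Nat.zero_le j) h

/-- Conjunction, disjunction, and the contraction of two like quantifiers. -/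
theorem closure (hp : HasPairing E) (j : ℕ) :
    (∀ {B : ℕ} {P Q : (ℕ → M) → Prop}, SigD E j B P → SigD E j B Q →
      SigD E j B (fun v => P v ∧ Q v) ∧ SigD E j B (fun v => P v ∨ Q v)) ∧
    (∀ {B : ℕ} {Q : (ℕ → M) → Prop}, SigD E j (B + 2) Q →
      SigD E (j + 1) B fun v => ∃ a b, ¬ Q (scons b (scons a v))) := by
  have key {z : M} {v : ℕ → M} {a b : M} : scons b (scons a (scons z v)) ∘
      (fun l => if l < 2 then l else l + 1) = scons b (scons a v) := by
    funext l
    rcases l with _ | _ | l <;> simp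
  have hlt (B : ℕ) : ∀ l < B + 2, (if l < 2 then l else l + 1) < B + 1 + 2 := by
    intro l hl; split_ifs <;> omega
  induction j with
  | zero =>
    refine ⟨fun h k => ⟨DefD0.and h k, DefD0.or h k⟩, fun {B Q} h => ?_⟩
    refine ⟨_, DefD0.not (DefD0.exists_isOPairOf (B := B + 1) (z := 0) (by omega)
      (DefD0.rename (DefD0.not h) (hlt B) fun _ => Iff.rfl)), fun v => ?_⟩
    simp only [key, not_not, scons_zero]
    constructor
    · rintro ⟨a, b, h⟩
      obtain ⟨z, hz⟩ := hp.exists_pair a b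
      exact ⟨z, a, b, hz, h⟩
    · rintro ⟨-, a, b, -, h⟩
      exact ⟨a, b, h⟩
  | succ j ih =>
    obtain ⟨ihb, ihc⟩ := ih
    have hex {B : ℕ} {P : (ℕ → M) → Prop} (h : SigD E (j + 1) (B + 1) P) :
        SigD E (j + 1) B fun v => ∃ a, P (scons a v) := by
      obtain ⟨Q, hQ, hPQ⟩ := h
      exact (ihc hQ).congr fun v => by simp only [hPQ]
    have hbool {B : ℕ} {P Q : (ℕ → M) → Prop} (hP : SigD E (j + 1) B P)
        (hQ : SigD E (j + 1) B Q) : SigD E (j + 1) B (fun v => P v ∧ Q v) ∧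
          SigD E (j + 1) B (fun v => P v ∨ Q v) := by
      obtain ⟨P₀, hP₀, eP⟩ := hP
      obtain ⟨Q₀, hQ₀, eQ⟩ := hQ
      have hP₁ : SigD E j (B + 2) fun w => P₀ (w ∘ fun l => if l = 0 then 1 else l + 1) :=
        hP₀.rename (fun l hl => by split_ifs <;> omega) fun _ => Iff.rfl
      have hQ₁ : SigD E j (B + 2) fun w => Q₀ (w ∘ fun l => if l = 0 then 0 else l + 1) :=
        hQ₀.rename (fun l hl => by split_ifs <;> omega) fun _ => Iff.rfl
      have e1 (v : ℕ → M) (a b : M) :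
          scons b (scons a v) ∘ (fun l => if l = 0 then 1 else l + 1) = scons a v := by
        funext l; rcases l with _ | l <;> simp
      have e2 (v : ℕ → M) (a b : M) :
          scons b (scons a v) ∘ (fun l => if l = 0 then 0 else l + 1) = scons b v := by
        funext l; rcases l with _ | l <;> simp
      constructor
      · refine (ihc (ihb hP₁ hQ₁).2).congr fun v => ?_
        simp only [e1, e2, eP, eQ, not_or, exists_and_left, exists_and_right]
      · refine (ihc (ihb hP₁ hQ₁).1).congr fun v => ?_
        simp only [e1, e2, eP, eQ, not_and_or, exists_or, exists_const]
    refine ⟨hbool, fun {B Q} h => ?_⟩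
    have hpr {B : ℕ} : DefD0 E (B + 1) fun v => ∃ a b, IsOPairOf E (v 0) a b := by
      refine (DefD0.exists_isOPairOf (z := 0) (by omega)
        (DefD0.eq (i := 0) (j := 0) (by omega) (by omega))).congr fun v => by simp
    have hQ' : SigD E (j + 1) (B + 1) fun v => ∃ a b, IsOPairOf E (v 0) a b ∧
        Q (scons b (scons a v) ∘ fun l => if l < 2 then l else l + 1) :=
      hex (P := fun v => ∃ b, IsOPairOf E (v 1) (v 0) b ∧
        Q (scons b v ∘ fun l => if l < 2 then l else l + 1))
        (hex (P := fun v => IsOPairOf E (v 2) (v 1) (v 0) ∧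
          Q (v ∘ fun l => if l < 2 then l else l + 1))
        (hbool (of_defD0 (DefD0.isOPairOf (by omega) (by omega) (by omega)))
          (h.rename (hlt B) fun _ => Iff.rfl)).1)
    refine ⟨_, (hbool (of_defD0 hpr.not) hQ').2, fun v => ?_⟩
    simp only [key, scons_zero]
    push Not
    constructor
    · rintro ⟨a, b, h⟩
      obtain ⟨z, hz⟩ := hp.exists_pair a b
      refine ⟨z, ⟨a, b, hz⟩, fun a' b' hz' => ?_⟩
      obtain ⟨rfl, rfl⟩ := hp.inj hz hz'
      exact h
    · rintro ⟨z, ⟨a, b, hz⟩, h⟩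
      exact ⟨a, b, h a b hz⟩

theorem and (hp : HasPairing E) (hP : SigD E j B P) (hQ : SigD E j B Q) :
    SigD E j B fun v => P v ∧ Q v :=
  ((closure hp j).1 hP hQ).1

theorem ex (hp : HasPairing E) (h : SigD E (j + 1) (B + 1) P) :
    SigD E (j + 1) B fun v => ∃ a, P (scons a v) := by
  obtain ⟨Q, hQ, hPQ⟩ := h
  exact ((closure hp j).2 hQ).congr fun v => by simp only [hPQ]

end SigD

theorem exists_sigD_of_isSigma (E : M → M → Prop) (j : ℕ) (φ : Fml) :
    (IsSigma j φ → ∃ B, SigD E j B fun v => Sat E v φ) ∧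
    (IsPi j φ → ∃ B, SigD E j B fun v => ¬ Sat E v φ) := by
  induction j generalizing φ with
  | zero =>
    obtain ⟨B, hB⟩ := φ.exists_fv_bound
    have h (hφ : IsDelta0 φ) : DefD0 E B fun v => Sat E v φ := ⟨φ, hφ, hB, fun _ => Iff.rfl⟩
    exact ⟨fun hφ => ⟨B, h hφ⟩, fun hφ => ⟨B, (h hφ).not⟩⟩
  | succ j ih =>
    have key (i : ℕ) (v : ℕ → M) (a : M) :
        scons a v ∘ (fun l => if l = i then 0 else l + 1) = Function.update v i a := by
      funext l
      by_cases h : l = i <;> simp [h]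
    have hlt (i B : ℕ) : ∀ l < B, (if l = i then 0 else l + 1) < B + 1 := by
      intro l hl; split_ifs <;> omega
    constructor
    · rintro ⟨i, ψ, hψ, rfl⟩
      obtain ⟨B, hB⟩ := (ih ψ).2 hψ
      exact ⟨B, _, hB.rename (hlt i B) fun _ => Iff.rfl, fun v => by simp [key]⟩
    · rintro ⟨i, ψ, hψ, rfl⟩
      obtain ⟨B, hB⟩ := (ih ψ).1 hψ
      exact ⟨B, _, hB.rename (hlt i B) fun _ => Iff.rfl, fun v => by simp [key]⟩

/-! ### Pointclasses -/

/-- A class of definable predicates closed under conjunction and existential quantification. -/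
structure IsPointclass (E : M → M → Prop) (Γ : ℕ → ((ℕ → M) → Prop) → Prop) : Prop where
  of_defD0 : ∀ {B P}, DefD0 E B P → Γ B P
  rename : ∀ {B C P} {ρ : ℕ → ℕ}, Γ B P → (∀ l < B, ρ l < C) → Γ C fun v => P (v ∘ ρ)
  and : ∀ {B P Q}, Γ B P → Γ B Q → Γ B fun v => P v ∧ Q v
  ex : ∀ {B P}, Γ (B + 1) P → Γ B fun v => ∃ a, P (scons a v)
  supp : ∀ {B P} {v w : ℕ → M}, Γ B P → (∀ l < B, v l = w l) → (P v ↔ P w)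

theorem SigD.isPointclass [Nonempty M] {E : M → M → Prop} (hp : HasPairing E) (j : ℕ) :
    IsPointclass E (SigD E (j + 1)) where
  of_defD0 := .of_defD0
  rename h hρ := h.rename hρ fun _ => Iff.rfl
  and := .and hp
  ex := .ex hp
  supp h hvw := h.supp hvw

/-- The predicates definable, without bound on complexity, in the variables below `B`. -/
def AllD (E : M → M → Prop) (B : ℕ) (P : (ℕ → M) → Prop) : Prop := ∃ j, SigD E j B P

theorem AllD.isPointclass [Nonempty M] {E : M → M → Prop} (hp : HasPairing E) :
    IsPointclass E (AllD E) where
  of_defD0 h := ⟨0, h⟩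
  rename := fun ⟨j, h⟩ hρ => ⟨j, h.rename hρ fun _ => Iff.rfl⟩
  and := fun ⟨j, h⟩ ⟨k, h'⟩ =>
    ⟨max j k, (h.mono_level (le_max_left j k)).and hp (h'.mono_level (le_max_right j k))⟩
  ex := fun ⟨j, h⟩ => ⟨j + 1, h.succ.ex hp⟩
  supp := fun ⟨_, h⟩ hvw => h.supp hvw

theorem exists_allD_sat [Nonempty M] {E : M → M → Prop} (hp : HasPairing E) (φ : Fml) :
    ∃ B, AllD E B fun v => Sat E v φ := by
  have hnot {B : ℕ} {P : (ℕ → M) → Prop} (h : AllD E B P) : AllD E B fun v => ¬ P v :=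
    h.imp' _ fun _ h => h.not_succ
  have hmono {B C : ℕ} {P : (ℕ → M) → Prop} (h : AllD E B P) (hBC : B ≤ C) : AllD E C P :=
    h.imp fun _ h => h.mono hBC
  have hand {B C : ℕ} {P Q : (ℕ → M) → Prop} (h : AllD E B P) (k : AllD E C Q) :
      AllD E (max B C) fun v => P v ∧ Q v :=
    (AllD.isPointclass hp).and (hmono h (le_max_left B C)) (hmono k (le_max_right B C))
  have hex {B : ℕ} {P : (ℕ → M) → Prop} (i : ℕ) (h : AllD E B P) :
      AllD E B fun v => ∃ a, P (Function.update v i a) := by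
    have := (AllD.isPointclass hp).ex ((AllD.isPointclass hp).rename (C := B + 1)
      (ρ := fun l => if l = i then 0 else l + 1) h fun l hl => by split_ifs <;> omega)
    convert this using 6 with v a
    funext l
    by_cases h : l = i <;> simp [h]
  induction φ with
  | mem i j => exact ⟨max i j + 1, 0, .mem (by omega) (by omega)⟩
  | eq i j => exact ⟨max i j + 1, 0, .eq (by omega) (by omega)⟩
  | not φ ih => exact ih.imp fun _ => hnot
  | and φ ψ ih ih' =>
    obtain ⟨⟨B, h⟩, ⟨C, k⟩⟩ := And.intro ih ih'
    exact ⟨_, hand h k⟩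
  | or φ ψ ih ih' =>
    obtain ⟨⟨B, h⟩, ⟨C, k⟩⟩ := And.intro ih ih'
    refine ⟨max B C, cast ?_ (hnot (hand (hnot h) (hnot k)))⟩
    simp only [sat_or, not_and_or, not_not]
  | imp φ ψ ih ih' =>
    obtain ⟨⟨B, h⟩, ⟨C, k⟩⟩ := And.intro ih ih'
    refine ⟨max B C, cast ?_ (hnot (hand h (hnot k)))⟩
    simp only [sat_imp, not_and_not_right]
  | all i φ ih =>
    obtain ⟨B, h⟩ := ih
    refine ⟨B, cast ?_ (hnot (hex i (hnot h)))⟩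
    simp only [sat_all, not_exists, not_not]
  | ex i φ ih =>
    obtain ⟨B, h⟩ := ih
    refine ⟨B, cast ?_ (hex i h)⟩
    simp only [sat_ex]

namespace IsPointclass

variable {E : M → M → Prop} {Γ : ℕ → ((ℕ → M) → Prop) → Prop}

theorem mono (hΓ : IsPointclass E Γ) {B C : ℕ} {P : (ℕ → M) → Prop} (h : Γ B P) (hBC : B ≤ C) :
    Γ C P :=
  hΓ.rename (ρ := id) h fun _ hl => hl.trans_le hBC

theorem exists_rename (hΓ : IsPointclass E Γ) {P : (ℕ → M) → Prop} (h : ∃ B, Γ B P) (ρ : ℕ → ℕ) :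
    ∃ B, Γ B fun v => P (v ∘ ρ) := by
  obtain ⟨B, h⟩ := h
  refine ⟨(Finset.range B).sup ρ + 1, hΓ.rename h fun l hl => Nat.lt_succ_of_le ?_⟩
  exact Finset.le_sup (Finset.mem_range.2 hl)

theorem exists_and (hΓ : IsPointclass E Γ) {P Q : (ℕ → M) → Prop} (h : ∃ B, Γ B P)
    (k : ∃ B, Γ B Q) : ∃ B, Γ B fun v => P v ∧ Q v := by
  obtain ⟨⟨B, h⟩, ⟨C, k⟩⟩ := And.intro h k
  exact ⟨_, hΓ.and (hΓ.mono h (le_max_left B C)) (hΓ.mono k (le_max_right B C))⟩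

theorem ex_update (hΓ : IsPointclass E Γ) {B : ℕ} {P : (ℕ → M) → Prop} (i : ℕ) (h : Γ B P) :
    Γ B fun v => ∃ a, P (Function.update v i a) := by
  have := hΓ.ex (hΓ.rename (C := B + 1) (ρ := fun l => if l = i then 0 else l + 1) h
    fun l hl => by split_ifs <;> omega)
  convert this using 6 with v a
  funext l
  by_cases h : l = i <;> simp [h]

theorem ex_finset (hΓ : IsPointclass E Γ) {B : ℕ} {P : (ℕ → M) → Prop} (h : Γ B P)
    (F : Finset ℕ) : Γ B fun v => ∃ w, (∀ l ∉ F, w l = v l) ∧ P w := by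
  induction F using Finset.induction_on with
  | empty =>
    convert h using 2 with v
    constructor
    · rintro ⟨w, hw, hP⟩
      obtain rfl : w = v := funext fun l => hw l (Finset.notMem_empty l)
      exact hP
    · exact fun hP => ⟨v, fun _ _ => rfl, hP⟩
  | insert i F hi ih =>
    convert hΓ.ex_update i ih using 2 with v
    constructor
    · rintro ⟨w, hw, hP⟩
      refine ⟨w i, w, fun l hl => ?_, hP⟩
      by_cases hli : l = i
      · simp [hli]
      · simpa [hli] using hw l (by simp [hli, hl])
    · rintro ⟨a, w, hw, hP⟩
      refine ⟨w, fun l hl => ?_, hP⟩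
      simp only [Finset.mem_insert, not_or] at hl
      simpa [hl.1] using hw l hl.2

/-- Collection with any finite number of parameters follows from collection with one. -/
theorem coll_params (hΓ : IsPointclass E Γ) (hp : HasPairing E)
    (hc : ∀ P, Γ 3 P → ∀ u p : M, (∀ x, E x p → ∃ y, ¬ P (scons y (scons x fun _ => u))) →
      ∃ q, ∀ x, E x p → ∃ y, E y q ∧ ¬ P (scons y (scons x fun _ => u)))
    (C : ℕ) {R : (ℕ → M) → Prop} (hR : Γ (C + 3) R) (u : ℕ → M) (p : M)
    (h : ∀ x, E x p → ∃ y, ¬ R (scons y (scons x u))) :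
    ∃ q, ∀ x, E x p → ∃ y, E y q ∧ ¬ R (scons y (scons x u)) := by
  induction C generalizing R u with
  | zero =>
    have key (x y : M) : R (scons y (scons x u)) ↔ R (scons y (scons x fun _ => u 0)) := by
      refine hΓ.supp hR fun l hl => ?_
      rcases l with _ | _ | _ | l
      · rfl
      · rfl
      · rfl
      · omega
    simp only [key] at h ⊢
    exact hc R hR (u 0) p h
  | succ C ih =>
    let ρ : ℕ → ℕ
      | 0 => 2
      | 1 => 3
      | 2 => 1
      | 3 => 0
      | l + 4 => l + 5
    have hρ : ∀ l < C + 1 + 3, ρ l < C + 3 + 1 + 1 := by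
      rintro (_ | _ | _ | _ | l) hl <;> simp only [ρ] <;> omega
    have comp (x y z a d : M) (w : ℕ → M) :
        scons d (scons a (scons y (scons x (scons z w)))) ∘ ρ =
          scons y (scons x (scons a (scons d w))) := by
      funext l
      rcases l with _ | _ | _ | _ | l <;> rfl
    have hR' : Γ (C + 3) fun w => ∃ a d, IsOPairOf E (w 2) a d ∧ R (scons d (scons a w) ∘ ρ) :=
      hΓ.ex (P := fun w => ∃ d, IsOPairOf E (w 3) (w 0) d ∧ R (scons d w ∘ ρ))
        (hΓ.ex (P := fun w => IsOPairOf E (w 4) (w 1) (w 0) ∧ R (w ∘ ρ))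
          (hΓ.and (hΓ.of_defD0 (.isOPairOf (by omega) (by omega) (by omega))) (hΓ.rename hR hρ)))
    obtain ⟨z, hz⟩ := hp.exists_pair (u 0) (u 1)
    have hu : u = scons (u 0) (scons (u 1) fun l => u (l + 2)) := by
      funext l
      rcases l with _ | _ | l <;> rfl
    have key (x y : M) : (∃ a d, IsOPairOf E z a d ∧
        R (scons d (scons a (scons y (scons x (scons z fun l => u (l + 2))))) ∘ ρ)) ↔
          R (scons y (scons x u)) := by
      simp only [comp]
      constructor
      · rintro ⟨a, d, hz', hr⟩
        obtain ⟨rfl, rfl⟩ := hp.inj hz hz'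
        rwa [hu]
      · intro hr
        rw [hu] at hr
        exact ⟨_, _, hz, hr⟩
    have := ih hR' (scons z fun l => u (l + 2))
    simp only [scons_succ, scons_zero, key] at this
    exact this h

end IsPointclass

/-! ### Large conditions and generic filters -/

section Generic

variable {E : M → M → Prop} {e : ℕ → M}

/-- Valuations in which the variable `2 * i + 2` names `e i` and the variable `0` names a
transitive set. -/
def Adm (E : M → M → Prop) (e : ℕ → M) (v : ℕ → M) : Prop :=
  (∀ i, v (2 * i + 2) = e i) ∧ TransIn E (v 0)

/-- `A` is compatible with the variable `0` being arbitrarily tall. -/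
def Large (E : M → M → Prop) (e : ℕ → M) (A : (ℕ → M) → Prop) : Prop :=
  ∀ b, ∃ v, Adm E e v ∧ E b (v 0) ∧ A v

theorem Large.mono {A A' : (ℕ → M) → Prop} (h : Large E e A)
    (hA : ∀ v, Adm E e v → A v → A' v) : Large E e A' := fun b =>
  (h b).imp fun v hv => ⟨hv.1, hv.2.1, hA v hv.1 hv.2.2⟩

theorem large_true (htco : SatTCo E) : Large E e fun _ => True := by
  intro b
  obtain ⟨t, hb, ht⟩ := htco b
  refine ⟨fun l => if l = 0 then t else e (l / 2 - 1), ⟨fun i => ?_, ht⟩, hb, trivial⟩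
  simp

theorem Large.and_or_and_not (hpair : ∀ a b, ∃ p, IsPairOf E p a b) {A : (ℕ → M) → Prop}
    (h : Large E e A) (P : (ℕ → M) → Prop) :
    Large E e (fun v => A v ∧ P v) ∨ Large E e (fun v => A v ∧ ¬ P v) := by
  by_contra! hcon
  obtain ⟨h1, h2⟩ := hcon
  simp only [Large, not_forall, not_exists, not_and] at h1 h2
  obtain ⟨b, h1⟩ := h1
  obtain ⟨c, h2⟩ := h2
  obtain ⟨p, hp⟩ := hpair b c
  obtain ⟨v, hv, hpv, hA⟩ := h p
  by_cases hP : P v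
  · exact h1 v hv (hv.2 p hpv b ((hp b).2 (.inl rfl))) hA hP
  · exact h2 v hv (hv.2 p hpv c ((hp c).2 (.inr rfl))) hA hP

/-- A filter of predicates all of whose members are large. -/
structure IsLargeFilter (E : M → M → Prop) (e : ℕ → M) (U : ((ℕ → M) → Prop) → Prop) : Prop where
  adm : ∀ {P}, (∀ v, Adm E e v → P v) → U P
  and : ∀ {P Q}, U P → U Q → U fun v => P v ∧ Q v
  mono : ∀ {P Q}, U P → (∀ v, P v → Q v) → U Q
  large : ∀ {P}, U P → Large E e P

theorem exists_isLargeFilter {ι : Type*} [Countable ι] [Nonempty ι]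
    (G : ((ℕ → M) → Prop) → Prop) (hG : ∃ A, G A ∧ Large E e A)
    (X : ι → (ℕ → M) → Prop) (W : ι → Set ((ℕ → M) → Prop))
    (h : ∀ i A, G A → Large E e (fun v => A v ∧ X i v) →
      ∃ Y ∈ W i, G (fun v => A v ∧ Y v) ∧ Large E e fun v => A v ∧ Y v) :
    ∃ U, IsLargeFilter E e U ∧ ∀ i, U (X i) → ∃ Y ∈ W i, U Y := by
  obtain ⟨g, hg⟩ := exists_surjective_nat ι
  have step (n : ℕ) (A : {A // G A ∧ Large E e A}) : ∃ A' : {A // G A ∧ Large E e A},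
      (∀ v, A'.1 v → A.1 v) ∧ (Large E e (fun v => A.1 v ∧ X (g n) v) →
        ∃ Y ∈ W (g n), ∀ v, A'.1 v → Y v) := by
    by_cases hA : Large E e fun v => A.1 v ∧ X (g n) v
    · obtain ⟨Y, hY, hGY, hLY⟩ := h (g n) A.1 A.2.1 hA
      exact ⟨⟨_, hGY, hLY⟩, fun v hv => hv.1, fun _ => ⟨Y, hY, fun v hv => hv.2⟩⟩
    · exact ⟨A, fun _ => id, fun h => absurd h hA⟩
  choose s hs hs' using step
  obtain ⟨A₀, hA₀⟩ := hG
  let f : ℕ → {A // G A ∧ Large E e A} := fun n => Nat.rec ⟨A₀, hA₀⟩ s n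
  have hf {m n : ℕ} (hmn : m ≤ n) : ∀ v, (f n).1 v → (f m).1 v := by
    induction hmn with
    | refl => exact fun _ => id
    | step _ ih => exact fun v hv => ih v (hs _ _ v hv)
  refine ⟨fun P => ∃ n, ∀ v, Adm E e v → (f n).1 v → P v,
    ⟨fun h => ⟨0, fun v hv _ => h v hv⟩, ?_, ?_, ?_⟩, fun i => ?_⟩
  · rintro P Q ⟨m, hm⟩ ⟨n, hn⟩
    exact ⟨max m n, fun v hv hfv => ⟨hm v hv (hf (le_max_left m n) v hfv),
      hn v hv (hf (le_max_right m n) v hfv)⟩⟩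
  · rintro P Q ⟨m, hm⟩ hPQ
    exact ⟨m, fun v hv hfv => hPQ v (hm v hv hfv)⟩
  · rintro P ⟨m, hm⟩
    exact (f m).2.2.mono hm
  · rintro ⟨m, hm⟩
    obtain ⟨n, rfl⟩ := hg i
    have hl : Large E e fun v => (f n).1 v ∧ X (g n) v :=
      (f (max m n)).2.2.mono fun v hv hfv =>
        ⟨hf (le_max_right m n) v hfv, hm v hv (hf (le_max_left m n) v hfv)⟩
    obtain ⟨Y, hY, hYf⟩ := hs' n (f n) hl
    exact ⟨Y, hY, n + 1, fun v _ hfv => hYf v hfv⟩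

/-- Names for elements of a set that is itself named by a constant can be taken constant. -/
theorem exists_large_eq {Γ : ℕ → ((ℕ → M) → Prop) → Prop} (hΓ : IsPointclass E Γ)
    (hp : HasPairing E) (htco : SatTCo E)
    (hc : ∀ P, Γ 3 P → ∀ u p : M, (∀ x, E x p → ∃ y, ¬ P (scons y (scons x fun _ => u))) →
      ∃ q, ∀ x, E x p → ∃ y, E y q ∧ ¬ P (scons y (scons x fun _ => u)))
    {A : (ℕ → M) → Prop} (hA : ∃ B, Γ B A) (i : ℕ) (m : M)
    (hL : Large E e fun v => A v ∧ E (v i) m) : ∃ x, Large E e fun v => A v ∧ v i = x := by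
  classical
  obtain ⟨B, hA⟩ : ∃ B, Γ (B + 1) A ∧ i < B + 1 := by
    obtain ⟨B, hA⟩ := hA
    exact ⟨max B i, hΓ.mono hA (by omega), by omega⟩
  obtain ⟨hA, hiB⟩ := hA
  by_contra! hcon
  obtain ⟨v₀, hv₀, -⟩ := large_true (e := e) htco m
  let F : Finset ℕ := ((Finset.range (B + 1)).filter fun l => ∀ k, l ≠ 2 * k + 2).image (· + 2)
  have hF (l : ℕ) : l + 2 ∈ F ↔ l < B + 1 ∧ ∀ k, l ≠ 2 * k + 2 := by simp [F]
  have hF0 : 0 ∉ F := by simp [F]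
  have hF1 : 1 ∉ F := by simp [F]
  have hW : Γ (B + 3) fun w => A (w ∘ fun l => l + 2) ∧
      TransIn E (w 2) ∧ E (w 0) (w 2) ∧ w (i + 2) = w 1 :=
    hΓ.and (hΓ.rename hA fun l hl => by omega) (hΓ.of_defD0
      ((DefD0.transIn (by omega)).and ((DefD0.mem (by omega) (by omega)).and
        (DefD0.eq (by omega) (by omega)))))
  obtain ⟨q, hq⟩ := hΓ.coll_params hp hc B (hΓ.ex_finset hW F) v₀ m fun x _ => by
    have := hcon x
    simp only [Large, not_forall, not_exists, not_and] at this
    obtain ⟨b, hb⟩ := this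
    refine ⟨b, ?_⟩
    rintro ⟨w, hw, hAw, hT, hbw, hx⟩
    have hw0 : w 0 = b := hw 0 hF0
    have hw1 : w 1 = x := hw 1 hF1
    refine hb (w ∘ fun l => l + 2) ⟨fun k => ?_, hT⟩ (hw0 ▸ hbw) hAw (hx.trans hw1)
    exact (hw (2 * k + 2 + 2) fun h => ((hF _).1 h).2 k rfl).trans (hv₀.1 k)
  obtain ⟨v, hv, hqv, hAv, hvi⟩ := hL q
  obtain ⟨b, hbq, hb⟩ := hq (v i) hvi
  let v' : ℕ → M := fun l => if l + 2 ∈ F then v l else v₀ l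
  have hv' : ∀ l < B + 1, v' l = v l := by
    intro l hl
    by_cases h : l + 2 ∈ F
    · simp [v', h]
    · obtain ⟨k, rfl⟩ : ∃ k, l = 2 * k + 2 := by
        by_contra! hk
        exact h ((hF l).2 ⟨hl, hk⟩)
      simp [v', h, hv₀.1, hv.1]
  refine hb ⟨scons b (scons (v i) v'), fun l hl => ?_, ?_⟩
  · rcases l with _ | _ | l
    · rfl
    · rfl
    · simp [v', hl]
  · have h0 := hv' 0 (by omega)
    refine ⟨(hΓ.supp hA hv').2 hAv, ?_, ?_, hv' i hiB⟩
    · simpa [h0] using hv.2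
    · simpa [h0] using hv.2 q hqv b hbq

/-- A large filter that is generic for the pointclass `Γ`. -/
structure IsGeneric (E : M → M → Prop) (e : ℕ → M) (Γ : ℕ → ((ℕ → M) → Prop) → Prop)
    (U : ((ℕ → M) → Prop) → Prop) : Prop extends IsLargeFilter E e U where
  decide : ∀ (φ : Fml) (ρ : ℕ →₀ ℕ), (∃ B, Γ B fun v => Sat E v φ) →
    (∃ B, Γ B fun v => ¬ Sat E v φ) →
    U (fun v => Sat E (v ∘ ρ) φ) ∨ U (fun v => ¬ Sat E (v ∘ ρ) φ)
  henkin : ∀ (φ : Fml) (ρ : ℕ →₀ ℕ) (i : ℕ), (∃ B, Γ B fun v => Sat E v φ) →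
    U (fun v => ∃ a, Sat E (Function.update (v ∘ ρ) i a) φ) →
    ∃ k, U fun v => Sat E (v ∘ ρ.update i k) φ
  eq_const : ∀ i j, U (fun v => E (v i) (v (2 * j + 2))) → ∃ l, U fun v => v i = v (2 * l + 2)

theorem exists_isGeneric {Γ : ℕ → ((ℕ → M) → Prop) → Prop} (hΓ : IsPointclass E Γ)
    (hDB : SatDB0 E) (htco : SatTCo E) (he : Function.Surjective e)
    (hc : ∀ P, Γ 3 P → ∀ u p : M, (∀ x, E x p → ∃ y, ¬ P (scons y (scons x fun _ => u))) →
      ∃ q, ∀ x, E x p → ∃ y, E y q ∧ ¬ P (scons y (scons x fun _ => u))) :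
    ∃ U, IsGeneric E e Γ U := by
  have hp := hDB.hasPairing
  have hpair := hDB.2.2.1
  let Good (φ : Fml) : Prop := ∃ B, Γ B fun v => Sat E v φ
  let I : Type := ({φ : Fml // Good φ ∧ Good φ.not} × (ℕ →₀ ℕ)) ⊕
    ({φ : Fml // Good φ} × (ℕ →₀ ℕ) × ℕ) ⊕ (ℕ × ℕ)
  let X : I → (ℕ → M) → Prop
    | .inl _ => fun _ => True
    | .inr (.inl ⟨φ, ρ, i⟩) => fun v => ∃ a, Sat E (Function.update (v ∘ ρ) i a) φ.1
    | .inr (.inr ⟨i, j⟩) => fun v => E (v i) (v (2 * j + 2))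
  let W : I → Set ((ℕ → M) → Prop)
    | .inl ⟨φ, ρ⟩ => {fun v => Sat E (v ∘ ρ) φ.1, fun v => ¬ Sat E (v ∘ ρ) φ.1}
    | .inr (.inl ⟨φ, ρ, i⟩) => Set.range fun k v => Sat E (v ∘ ρ.update i k) φ.1
    | .inr (.inr ⟨i, _⟩) => Set.range fun l v => v i = v (2 * l + 2)
  have : Nonempty I := ⟨.inr (.inr (0, 0))⟩
  have dense : ∀ i A, (∃ B, Γ B A) → Large E e (fun v => A v ∧ X i v) →
      ∃ Y ∈ W i, (∃ B, Γ B fun v => A v ∧ Y v) ∧ Large E e fun v => A v ∧ Y v := by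
    rintro (⟨⟨φ, h, h'⟩, ρ⟩ | ⟨⟨φ, h⟩, ρ, i⟩ | ⟨i, j⟩) A hA hL
    · have hA' : Large E e A := hL.mono fun v _ hv => hv.1
      rcases hA'.and_or_and_not hpair fun v => Sat E (v ∘ ρ) φ with h1 | h1
      · exact ⟨_, .inl rfl, hΓ.exists_and hA (hΓ.exists_rename h ρ), h1⟩
      · exact ⟨_, .inr rfl, hΓ.exists_and hA (hΓ.exists_rename h' ρ), h1⟩
    · obtain ⟨B, hB⟩ := hA
      obtain ⟨C, hC⟩ := h
      let k := 2 * (B + (Finset.range C).sup ρ) + 1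
      refine ⟨_, ⟨k, rfl⟩, hΓ.exists_and ⟨B, hB⟩ (hΓ.exists_rename ⟨C, hC⟩ _), fun b => ?_⟩
      obtain ⟨v, hv, hbv, hAv, a, ha⟩ := hL b
      have h0 : Function.update v k a 0 = v 0 := Function.update_of_ne (by omega) _ _
      refine ⟨Function.update v k a, ⟨fun n => ?_, h0 ▸ hv.2⟩, h0 ▸ hbv, ?_, ?_⟩
      · rw [Function.update_of_ne (by omega), hv.1]
      · exact (hΓ.supp hB fun l hl => Function.update_of_ne (by omega) _ _).2 hAv
      · refine (hΓ.supp hC fun l hl => ?_).2 ha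
        by_cases hli : l = i
        · simp [hli]
        · have : ρ l ≤ (Finset.range C).sup ρ := Finset.le_sup (Finset.mem_range.2 hl)
          have hk : ρ l ≠ k := by omega
          simp [hli, hk]
    · obtain ⟨x, hx⟩ := exists_large_eq hΓ hp htco hc hA i (e j)
        (hL.mono fun v hv h => ⟨h.1, hv.1 j ▸ h.2⟩)
      obtain ⟨l, rfl⟩ := he x
      refine ⟨_, ⟨l, rfl⟩, hΓ.exists_and hA ⟨max i (2 * l + 2) + 1, hΓ.of_defD0
        (.eq (by omega) (by omega))⟩, hx.mono fun v hv h => ⟨h.1, h.2.trans (hv.1 l).symm⟩⟩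
  obtain ⟨U, hU, hUI⟩ := exists_isLargeFilter _ ⟨_, ⟨1, hΓ.of_defD0
    ((DefD0.eq (i := 0) (j := 0) one_pos one_pos).congr fun _ => (iff_true_right rfl).2 trivial)⟩,
    large_true htco⟩ X W dense
  refine ⟨U, hU, fun φ ρ h h' => ?_, fun φ ρ i h hex => ?_, fun i j h => ?_⟩
  · obtain ⟨Y, rfl | rfl, hY⟩ := hUI (.inl (⟨φ, h, h'⟩, ρ)) (hU.adm fun _ _ => trivial)
    exacts [.inl hY, .inr hY]
  · obtain ⟨_, ⟨k, rfl⟩, hY⟩ := hUI (.inr (.inl (⟨φ, h⟩, ρ, i))) hex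
    exact ⟨k, hY⟩
  · obtain ⟨_, ⟨k, rfl⟩, hY⟩ := hUI (.inr (.inr (i, j))) h
    exact ⟨k, hY⟩

end Generic

/-! ### The term model of a generic filter -/

section TermModel

variable {E : M → M → Prop} {e : ℕ → M} {U : ((ℕ → M) → Prop) → Prop}
  {EN : N → N → Prop} {f : M → N} {q : ℕ → N}

/-- The elements of `N` are named by variables, with atomic facts determined by `U`. -/
structure IsTermModel (E : M → M → Prop) (e : ℕ → M) (U : ((ℕ → M) → Prop) → Prop)
    (EN : N → N → Prop) (f : M → N) (q : ℕ → N) : Prop where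
  surjective : Function.Surjective q
  eq_iff : ∀ i j, q i = q j ↔ U fun v => v i = v j
  mem_iff : ∀ i j, EN (q i) (q j) ↔ U fun v => E (v i) (v j)
  apply_const : ∀ l, f (e l) = q (2 * l + 2)

theorem IsLargeFilter.const_iff (hU : IsLargeFilter E e U) {p : Prop} {P : (ℕ → M) → Prop}
    (h : ∀ v, Adm E e v → (P v ↔ p)) : U P ↔ p := by
  refine ⟨fun hP => ?_, fun hp => hU.adm fun v hv => (h v hv).2 hp⟩
  obtain ⟨v, hv, -, hPv⟩ := hU.large hP (e 0)
  exact (h v hv).1 hPv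

theorem IsLargeFilter.not_and_not (hU : IsLargeFilter E e U) {P : (ℕ → M) → Prop}
    (h : U P) (h' : U fun v => ¬ P v) : False := by
  obtain ⟨v, -, -, hv⟩ := hU.large (hU.and h h') (e 0)
  exact hv.2 hv.1

theorem IsLargeFilter.exists_isTermModel (hU : IsLargeFilter E e U)
    (he : Function.Surjective e) :
    ∃ (N : Type) (EN : N → N → Prop) (f : M → N) (q : ℕ → N), IsTermModel E e U EN f q := by
  let S : Setoid ℕ :=
    { r := fun i j => U fun v => v i = v j
      iseqv := ⟨fun i => hU.adm fun _ _ => rfl, fun h => hU.mono h fun _ => Eq.symm,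
        fun h h' => hU.mono (hU.and h h') fun _ hv => hv.1.trans hv.2⟩ }
  have hcongr {i j i' j' : ℕ} (h : U fun v => v i = v i') (h' : U fun v => v j = v j')
      (hm : U fun v => E (v i) (v j)) : U fun v => E (v i') (v j') :=
    hU.mono (hU.and (hU.and h h') hm) fun v hv => hv.1.1 ▸ hv.1.2 ▸ hv.2
  choose g hg using he
  refine ⟨Quotient S, Quotient.lift₂ (fun i j => U fun v => E (v i) (v j)) ?_,
    fun m => Quotient.mk S (2 * g m + 2), Quotient.mk S, Quotient.mk_surjective,
    fun i j => Quotient.eq, fun i j => Iff.rfl, fun l => Quotient.sound ?_⟩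
  · intro i j i' j' h h'
    exact propext ⟨hcongr h h', hcongr (S.symm h) (S.symm h')⟩
  · exact hU.adm fun v hv => by rw [hv.1, hv.1, hg]

namespace IsTermModel

theorem subStr (hN : IsTermModel E e U EN f q) (hU : IsLargeFilter E e U)
    (he : Function.Surjective e) : SubStr E EN f := by
  refine ⟨fun a b hab => ?_, fun a b => ?_⟩
  all_goals
    obtain ⟨i, rfl⟩ := he a
    obtain ⟨j, rfl⟩ := he b
    try rw [hN.apply_const, hN.apply_const] at hab
    try rw [hN.apply_const, hN.apply_const]
  · exact (hU.const_iff fun v hv => by rw [hv.1, hv.1]).1 ((hN.eq_iff _ _).1 hab)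
  · rw [hN.mem_iff]
    exact (hU.const_iff fun v hv => by rw [hv.1, hv.1]).symm

variable {Γ : ℕ → ((ℕ → M) → Prop) → Prop}

theorem isEndEmb (hN : IsTermModel E e U EN f q) (hU : IsGeneric E e Γ U)
    (he : Function.Surjective e) : IsEndEmb EN f := by
  intro m a ha
  obtain ⟨j, rfl⟩ := he m
  obtain ⟨i, rfl⟩ := hN.surjective a
  rw [hN.apply_const, hN.mem_iff] at ha
  obtain ⟨l, hl⟩ := hU.eq_const i j ha
  exact ⟨e l, (hN.apply_const l).trans ((hN.eq_iff _ _).2 (hU.mono hl fun _ => Eq.symm))⟩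

theorem tallerStar (hN : IsTermModel E e U EN f q) (hΓ : IsPointclass E Γ)
    (hU : IsGeneric E e Γ U) (he : Function.Surjective e) : TallerStar EN f := by
  have hdec (i : ℕ) : U (fun v => E (v i) (v 0)) ∨ U fun v => ¬ E (v i) (v 0) := by
    have h := hU.decide (.mem 0 1) (Finsupp.single 0 i)
      ⟨2, hΓ.of_defD0 (.mem (by omega) (by omega))⟩
      ⟨2, hΓ.of_defD0 (DefD0.mem (by omega) (by omega)).not⟩
    simpa using h
  refine ⟨q 0, fun m => ?_, fun x hx y hy => ?_⟩
  · obtain ⟨l, rfl⟩ := he m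
    rw [hN.apply_const, hN.mem_iff]
    refine (hdec _).resolve_right fun h => ?_
    obtain ⟨v, hv, hlv, hv'⟩ := hU.large h (e l)
    exact hv' (hv.1 l ▸ hlv)
  · obtain ⟨i, rfl⟩ := hN.surjective x
    obtain ⟨j, rfl⟩ := hN.surjective y
    rw [hN.mem_iff] at hx hy ⊢
    refine (hdec _).resolve_right fun h => ?_
    obtain ⟨v, hv, -, ⟨h1, h2⟩, h3⟩ := hU.large (hU.and (hU.and hx hy) h) (e 0)
    exact h3 (hv.2 _ h1 _ h2)

/-- Truth of `φ` in the term model is membership in the filter. -/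
def Truth (E : M → M → Prop) (U : ((ℕ → M) → Prop) → Prop) (EN : N → N → Prop) (q : ℕ → N)
    (φ : Fml) : Prop :=
  ∀ ρ : ℕ →₀ ℕ, Sat EN (q ∘ ρ) φ ↔ U fun v => Sat E (v ∘ ρ) φ

/-- `φ` defines a predicate in `Γ`. -/
def Good (E : M → M → Prop) (Γ : ℕ → ((ℕ → M) → Prop) → Prop) (φ : Fml) : Prop :=
  ∃ B, Γ B fun v => Sat E v φ

theorem comp_update {K : Type} (g : ℕ → K) (ρ : ℕ →₀ ℕ) (i k : ℕ) :
    g ∘ ρ.update i k = Function.update (g ∘ ρ) i (g k) := by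
  rw [Finsupp.coe_update, Function.comp_update]

variable {φ ψ : Fml}

theorem truth_mem (hN : IsTermModel E e U EN f q) (i j : ℕ) : Truth E U EN q (.mem i j) :=
  fun ρ => hN.mem_iff (ρ i) (ρ j)

theorem truth_eq (hN : IsTermModel E e U EN f q) (i j : ℕ) : Truth E U EN q (.eq i j) :=
  fun ρ => hN.eq_iff (ρ i) (ρ j)

theorem truth_not (hU : IsGeneric E e Γ U) (h : Good E Γ φ) (h' : Good E Γ φ.not)
    (hφ : Truth E U EN q φ) : Truth E U EN q φ.not := fun ρ => by
  rw [sat_not, hφ ρ]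
  exact ⟨fun hn => (hU.decide φ ρ h h').resolve_left hn, fun hn hp => hU.not_and_not hp hn⟩

theorem truth_and (hU : IsLargeFilter E e U) (hφ : Truth E U EN q φ)
    (hψ : Truth E U EN q ψ) : Truth E U EN q (φ.and ψ) := fun ρ => by
  rw [sat_and, hφ ρ, hψ ρ]
  exact ⟨fun h => hU.and h.1 h.2, fun h => ⟨hU.mono h fun _ => And.left,
    hU.mono h fun _ => And.right⟩⟩

theorem truth_or (hU : IsGeneric E e Γ U) (h : Good E Γ φ) (h' : Good E Γ φ.not)
    (hφ : Truth E U EN q φ) (hψ : Truth E U EN q ψ) : Truth E U EN q (φ.or ψ) := fun ρ => by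
  rw [sat_or, hφ ρ, hψ ρ]
  constructor
  · rintro (h | h)
    exacts [hU.mono h fun _ => .inl, hU.mono h fun _ => .inr]
  · intro hor
    refine (hU.decide φ ρ h h').imp_right fun hn => ?_
    exact hU.mono (hU.and hor hn) fun v hv => hv.1.resolve_left hv.2

theorem truth_imp (hU : IsGeneric E e Γ U) (h : Good E Γ φ) (h' : Good E Γ φ.not)
    (hφ : Truth E U EN q φ) (hψ : Truth E U EN q ψ) : Truth E U EN q (φ.imp ψ) := fun ρ => by
  rw [sat_imp, hφ ρ, hψ ρ]
  constructor
  · intro hi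
    rcases hU.decide φ ρ h h' with hp | hn
    · exact hU.mono (hi hp) fun _ hv _ => hv
    · exact hU.mono hn fun _ hv hv' => absurd hv' hv
  · exact fun hi hp => hU.mono (hU.and hi hp) fun v hv => hv.1 hv.2

theorem truth_ex (hN : IsTermModel E e U EN f q) (hU : IsGeneric E e Γ U) (i : ℕ)
    (h : Good E Γ φ) (hφ : Truth E U EN q φ) : Truth E U EN q (.ex i φ) := fun ρ => by
  simp only [sat_ex]
  constructor
  · rintro ⟨a, ha⟩
    obtain ⟨k, rfl⟩ := hN.surjective a
    rw [← comp_update, hφ] at ha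
    exact hU.mono ha fun v hv => ⟨v k, by rwa [comp_update] at hv⟩
  · intro hex
    obtain ⟨k, hk⟩ := hU.henkin φ ρ i h hex
    rw [← hφ, comp_update] at hk
    exact ⟨_, hk⟩

theorem truth_all (hN : IsTermModel E e U EN f q) (hU : IsGeneric E e Γ U) (i : ℕ)
    (hn : Good E Γ φ.not) (h : Good E Γ (.all i φ)) (h' : Good E Γ (Fml.all i φ).not)
    (hφ : Truth E U EN q φ) : Truth E U EN q (.all i φ) := fun ρ => by
  constructor
  · intro hall
    refine (hU.decide _ ρ h h').resolve_right fun hnot => ?_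
    obtain ⟨k, hk⟩ := hU.henkin φ.not ρ i hn (hU.mono hnot fun v hv => by simpa using hv)
    rw [sat_all] at hall
    have := hall (q k)
    rw [← comp_update, hφ] at this
    exact hU.not_and_not this hk
  · intro hall
    rw [sat_all]
    intro a
    obtain ⟨k, rfl⟩ := hN.surjective a
    rw [← comp_update, hφ]
    exact hU.mono hall fun v hv => by rw [comp_update]; exact sat_all.1 hv _

/-- Finitely many elements of `M` are named by constants. -/
theorem exists_names (hN : IsTermModel E e U EN f q) (he : Function.Surjective e) (φ : Fml)
    (v : ℕ → M) : ∃ ρ : ℕ →₀ ℕ, (∀ l ∈ φ.fv, f (v l) = q (ρ l)) ∧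
      ∀ w, Adm E e w → ∀ l ∈ φ.fv, w (ρ l) = v l := by
  classical
  choose g hg using he
  let ρ : ℕ →₀ ℕ := Finsupp.onFinset φ.fv_finite.toFinset
    (fun l => if l ∈ φ.fv then 2 * g (v l) + 2 else 0) fun l => by simp
  have hρ (l : ℕ) (hl : l ∈ φ.fv) : ρ l = 2 * g (v l) + 2 := by simp [ρ, hl]
  refine ⟨ρ, fun l hl => ?_, fun w hw l hl => ?_⟩
  · rw [hρ l hl, ← hN.apply_const, hg]
  · rw [hρ l hl, hw.1, hg]

theorem sat_iff (hN : IsTermModel E e U EN f q) (hU : IsLargeFilter E e U)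
    (he : Function.Surjective e) (hφ : Truth E U EN q φ) (v : ℕ → M) :
    Sat E v φ ↔ Sat EN (f ∘ v) φ := by
  obtain ⟨ρ, h1, h2⟩ := hN.exists_names he φ v
  rw [sat_congr (v := f ∘ v) (w := q ∘ ρ) h1, hφ]
  exact (hU.const_iff fun w hw => sat_congr (h2 w hw)).symm

/-- Truth of `φ` gives elementarity two quantifiers further up. -/
theorem sat_ex_all_iff (hN : IsTermModel E e U EN f q) (hU : IsGeneric E e Γ U)
    (he : Function.Surjective e) (hn : Good E Γ φ.not) (hφ : Truth E U EN q φ) (i j : ℕ)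
    (v : ℕ → M) : Sat E v (.ex i (.all j φ)) ↔ Sat EN (f ∘ v) (.ex i (.all j φ)) := by
  obtain ⟨ρ, h1, h2⟩ := hN.exists_names he (.ex i (.all j φ)) v
  rw [sat_congr (v := f ∘ v) (w := q ∘ ρ) h1]
  constructor
  · intro h
    obtain ⟨a, ha⟩ := sat_ex.1 h
    obtain ⟨l, rfl⟩ := he a
    refine sat_ex.2 ⟨q (2 * l + 2), sat_all.2 fun b => ?_⟩
    obtain ⟨k, rfl⟩ := hN.surjective b
    rw [← comp_update, ← comp_update, hφ]
    refine hU.adm fun w hw => ?_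
    rw [comp_update]
    refine sat_all.1 ((sat_congr fun x hx => ?_).2 ha) _
    rw [comp_update, hw.1]
    by_cases hxi : x = i
    · simp [hxi]
    · simpa [hxi] using h2 w hw x ⟨hx, hxi⟩
  · intro h
    by_contra hcon
    obtain ⟨a, ha⟩ := sat_ex.1 h
    obtain ⟨k, rfl⟩ := hN.surjective a
    rw [← comp_update, sat_all] at ha
    obtain ⟨k', hk'⟩ := hU.henkin φ.not (ρ.update i k) j hn (hU.adm fun w hw => by
      have hw' : ¬ Sat E (w ∘ ρ) (.ex i (.all j φ)) := by rwa [sat_congr (v := w ∘ ρ) (h2 w hw)]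
      simp only [sat_ex, sat_all, not_exists, not_forall] at hw'
      rw [comp_update]
      exact hw' (w k))
    have := ha (q k')
    rw [← comp_update, hφ] at this
    exact hU.not_and_not this hk'

theorem truth_of_forall_good (hN : IsTermModel E e U EN f q) (hU : IsGeneric E e Γ U)
    (h : ∀ φ, Good E Γ φ) (φ : Fml) : Truth E U EN q φ := by
  induction φ with
  | mem i j => exact hN.truth_mem i j
  | eq i j => exact hN.truth_eq i j
  | not φ ih => exact truth_not hU (h _) (h _) ih
  | and φ ψ ih ih' => exact truth_and hU.toIsLargeFilter ih ih'
  | or φ ψ ih ih' => exact truth_or hU (h _) (h _) ih ih'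
  | imp φ ψ ih ih' => exact truth_imp hU (h _) (h _) ih ih'
  | all i φ ih => exact hN.truth_all hU i (h _) (h _) (h _) ih
  | ex i φ ih => exact hN.truth_ex hU i (h _) ih

theorem truth_of_isSigma_or_isPi (hN : IsTermModel E e U EN f q) (hU : IsGeneric E e Γ U) {n : ℕ}
    (h : ∀ j ≤ n, ∀ φ, IsSigma j φ ∨ IsPi j φ → Good E Γ φ ∧ Good E Γ φ.not) :
    ∀ j ≤ n, ∀ φ, IsSigma j φ ∨ IsPi j φ → Truth E U EN q φ := by
  have h0 {φ : Fml} (hφ : IsDelta0 φ) := h 0 (Nat.zero_le n) φ (.inl hφ)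
  intro j
  induction j with
  | zero =>
    intro _ φ hφ
    replace hφ : IsDelta0 φ := hφ.elim id id
    induction hφ with
    | mem i j => exact hN.truth_mem i j
    | eq i j => exact hN.truth_eq i j
    | not h ih => exact truth_not hU (h0 h).1 (h0 h).2 ih
    | and h h' ih ih' => exact truth_and hU.toIsLargeFilter ih ih'
    | or h h' ih ih' => exact truth_or hU (h0 h).1 (h0 h).2 ih ih'
    | imp h h' ih ih' => exact truth_imp hU (h0 h).1 (h0 h).2 ih ih'
    | @ball i j φ hij h ih =>
      have hm := IsDelta0.mem i j
      exact hN.truth_all hU i (h0 (hm.imp h)).2 (h0 (.ball hij h)).1 (h0 (.ball hij h)).2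
        (truth_imp hU (h0 hm).1 (h0 hm).2 (hN.truth_mem i j) ih)
    | @bex i j φ hij h ih =>
      exact hN.truth_ex hU i (h0 ((IsDelta0.mem i j).and h)).1
        (truth_and hU.toIsLargeFilter (hN.truth_mem i j) ih)
  | succ j ih =>
    intro hj φ hφ
    have hφ' := h _ hj φ hφ
    have hj' : j ≤ n := Nat.le_of_succ_le hj
    rcases hφ with ⟨i, ψ, hψ, rfl⟩ | ⟨i, ψ, hψ, rfl⟩
    · exact hN.truth_ex hU i (h j hj' ψ (.inr hψ)).1 (ih hj' ψ (.inr hψ))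
    · exact hN.truth_all hU i (h j hj' ψ (.inl hψ)).2 hφ'.1 hφ'.2 (ih hj' ψ (.inl hψ))

end IsTermModel

end TermModel

/-- A collection axiom for a formula, as a statement about the predicate it defines. -/
theorem CollScheme.coll {E : M → M → Prop} {Δ : Fml → Prop} (hc : CollScheme E Δ)
    {j : ℕ} (hΔ : ∀ φ, IsSigma j φ → Δ φ) {P : (ℕ → M) → Prop} (hP : SigD E j 3 P) (u p : M)
    (h : ∀ x, E x p → ∃ y, P (scons y (scons x fun _ => u))) :
    ∃ q, ∀ x, E x p → ∃ y, E y q ∧ P (scons y (scons x fun _ => u)) := by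
  let ρ : ℕ → ℕ
    | 0 => 1
    | 1 => 0
    | l + 2 => l + 2
  have hρ : ∀ l < 3, ρ l < 3 := by
    rintro (_ | _ | l) hl <;> simp only [ρ] <;> omega
  obtain ⟨φ, h1, h2, h3⟩ := (hP.rename hρ fun _ => Iff.rfl).exists_formula.1
  have hfv : φ.fv ⊆ {0, 1, 2} := fun l hl => by
    have := h2 l hl
    simp only [Set.mem_insert_iff, Set.mem_singleton_iff]
    omega
  have key (x y : M) : Sat E (val3 x y u) φ ↔ P (scons y (scons x fun _ => u)) := by
    rw [← h3]
    have : val3 x y u ∘ ρ = scons y (scons x fun _ => u) := by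
      funext l
      rcases l with _ | _ | l <;> simp [ρ, val3]
    rw [this]
  have := hc φ (hΔ φ h1) hfv u p
  simp only [key] at this
  exact this h

/-- Every countable model of DB₀ + TCo + Coll(Σ_{n+2}) has a
Σ_{n+2}-elementary end extension that is taller*; moreover, every countable
model of DB₀ + TCo satisfying full Coll has a fully elementary end extension
that is taller*. -/
theorem countable_taller_star_extension (n : ℕ) :
    (∀ (M : Type) (EM : M → M → Prop), Countable M → SatDB0 EM → SatTCo EM →
      CollScheme EM (IsSigma (n + 2)) →
      ∃ (N : Type) (EN : N → N → Prop) (f : M → N),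
        SubStr EM EN f ∧ SigmaElemEmb (n + 2) EM EN f ∧ IsEndEmb EN f ∧
          TallerStar EN f) ∧
    (∀ (M : Type) (EM : M → M → Prop), Countable M → SatDB0 EM → SatTCo EM →
      CollScheme EM (fun _ => True) →
      ∃ (N : Type) (EN : N → N → Prop) (f : M → N),
        SubStr EM EN f ∧ ElemEmb EM EN f ∧ IsEndEmb EN f ∧
          TallerStar EN f) := by
  refine ⟨fun M EM _ hDB htco hc => ?_, fun M EM _ hDB htco hc => ?_⟩
  all_goals
    have : Nonempty M := ⟨hDB.2.1.choose⟩
    have hp := hDB.hasPairing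
    obtain ⟨e, he⟩ := exists_surjective_nat M
  · have hΓ := SigD.isPointclass hp n
    obtain ⟨U, hU⟩ := exists_isGeneric hΓ hDB htco he fun P hP =>
      hc.coll (fun _ => id) hP.not_succ
    obtain ⟨N, EN, f, q, hN⟩ := hU.toIsLargeFilter.exists_isTermModel he
    have hgood : ∀ j ≤ n, ∀ φ, IsSigma j φ ∨ IsPi j φ →
        IsTermModel.Good EM (SigD EM (n + 1)) φ ∧
          IsTermModel.Good EM (SigD EM (n + 1)) φ.not := by
      rintro j hj φ (hφ | hφ)
      · obtain ⟨B, hB⟩ := (exists_sigD_of_isSigma EM j φ).1 hφ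
        exact ⟨⟨B, hB.mono_level (by omega)⟩, ⟨B, hB.not_succ.mono_level (by omega)⟩⟩
      · obtain ⟨B, hB⟩ := (exists_sigD_of_isSigma EM j φ).2 hφ
        exact ⟨⟨B, (hB.not_succ.mono_level (by omega)).congr fun v => not_not.symm⟩,
          ⟨B, hB.mono_level (by omega)⟩⟩
    refine ⟨N, EN, f, hN.subStr hU.toIsLargeFilter he, ?_, hN.isEndEmb hU he,
      hN.tallerStar hΓ hU he⟩
    rintro _ ⟨i, _, ⟨j, σ, hσ, rfl⟩, rfl⟩ v
    exact hN.sat_ex_all_iff hU he (hgood n le_rfl σ (.inl hσ)).2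
      (hN.truth_of_isSigma_or_isPi hU hgood n le_rfl σ (.inl hσ)) i j v
  · have hΓ := AllD.isPointclass hp
    obtain ⟨U, hU⟩ := exists_isGeneric hΓ hDB htco he fun P ⟨_, hP⟩ =>
      hc.coll (fun _ _ => trivial) hP.not_succ
    obtain ⟨N, EN, f, q, hN⟩ := hU.toIsLargeFilter.exists_isTermModel he
    exact ⟨N, EN, f, hN.subStr hU.toIsLargeFilter he, fun φ v => hN.sat_iff hU.toIsLargeFilter he
      (hN.truth_of_forall_good hU (exists_allD_sat hp) φ) v, hN.isEndEmb hU he,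
      hN.tallerStar hΓ hU he⟩

end FOSet
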